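/- arXiv:0911.3971 — 3 statements merged into one kernel-verified Lean document; each statement's English description precedes it below -/
import Mathlib

section
/- Let 0 < τ and let θ be a real number such that for some constant c' > 0, |θ − p/q| > c' / q^{2+τ} for all integers p and positive integers q. Then there is a constant C > 0 such that for all N ≥ 1 the discrepancy of the sequence of fractional parts ({nθ})_{n≥1} satisfies D_N({nθ}) ≤ C·N^{τ/(τ+1)}. -/
noncomputable section

/-- The counting function of the sequence `({nθ})_{n ≥ 1}`: the number of
`1 ≤ n ≤ N` with fractional part `{nθ} ∈ [0, x)`. -/
def fractCount (θ : ℝ) (N : ℕ) (x : ℝ) : ℕ :=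
  {n : ℕ | 1 ≤ n ∧ n ≤ N ∧ Int.fract ((n : ℝ) * θ) < x}.ncard

lemma fractCount_eq_card (θ : ℝ) (N : ℕ) (x : ℝ) :
    fractCount θ N x =
      ((Finset.Ioc 0 N).filter fun n : ℕ => Int.fract ((n : ℝ) * θ) < x).card := by
  rw [fractCount, ← Set.ncard_coe_finset]
  congr 1
  ext n
  simp [Nat.succ_le_iff, and_assoc]

lemma card_Icc_ceil_floor_le {a b : ℝ} (hab : a ≤ b) :
    ((Finset.Icc ⌈a⌉ ⌊b⌋).card : ℝ) ≤ b - a + 1 := by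
  rw [Int.card_Icc]
  have h : (((⌊b⌋ + 1 - ⌈a⌉).toNat : ℤ) : ℝ) ≤ b - a + 1 := by
    rw [Int.toNat_eq_max, Int.cast_max]
    refine max_le ?_ ?_
    · push_cast
      linarith [Int.floor_le b, Int.le_ceil a]
    · push_cast
      linarith
  exact_mod_cast h

/-- If `r` is a rational approximation of `θ` with `|θ - r| ≤ 1 / r.den ^ 2`, then a block of
`r.den` consecutive multiples of `θ` meets `[a, b)` modulo one at most `r.den * (b - a) + 3`
times. -/
lemma card_block_fract_mem_le {θ : ℝ} {r : ℚ} (hr : |(r.den : ℝ) * θ - r.num| * r.den ≤ 1)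
    (m : ℕ) {a b : ℝ} (hab : a ≤ b) :
    (((Finset.Ioc m (m + r.den)).filter fun n : ℕ =>
      a ≤ Int.fract ((n : ℝ) * θ) ∧ Int.fract ((n : ℝ) * θ) < b).card : ℝ) ≤
      r.den * (b - a) + 3 := by
  set q := r.den with hq
  set p := r.num with hp
  have hq0 : (0 : ℝ) < q := by exact_mod_cast r.den_pos
  set e : ℝ := p - q * θ with he
  set A : ℝ := q * a + m * e - 1 with hA
  set B : ℝ := q * b + m * e + 1 with hB
  have hAB : A ≤ B := by
    have := mul_le_mul_of_nonneg_left hab hq0.le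
    linarith
  have hcard := card_Icc_ceil_floor_le hAB
  refine le_trans (Nat.cast_le.mpr (Finset.card_le_card_of_injOn
    (fun n : ℕ => (n : ℤ) * p - q * ⌊(n : ℝ) * θ⌋) ?_ ?_)) (hcard.trans (by linarith))
  · intro n hn
    simp only [Finset.coe_filter, Finset.mem_Ioc, Set.mem_ofPred_eq] at hn
    obtain ⟨⟨hmn, hnm⟩, han, hnb⟩ := hn
    have hc : (((n : ℤ) * p - q * ⌊(n : ℝ) * θ⌋ : ℤ) : ℝ)
        = q * Int.fract ((n : ℝ) * θ) + m * e + (n - m) * e := by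
      rw [Int.fract]
      push_cast
      rw [he]
      ring
    have hsmall : |((n : ℝ) - m) * e| ≤ 1 := by
      have h1 : (m : ℝ) < n := by exact_mod_cast hmn
      have h2 : (n : ℝ) ≤ m + q := by exact_mod_cast hnm
      rw [abs_mul, abs_of_pos (by linarith), he, abs_sub_comm, mul_comm]
      exact le_trans (mul_le_mul_of_nonneg_left (by linarith) (abs_nonneg _)) hr
    rw [abs_le] at hsmall
    have h3 := mul_le_mul_of_nonneg_left han hq0.le
    have h4 := mul_le_mul_of_nonneg_left hnb.le hq0.le
    rw [Finset.mem_coe, Finset.mem_Icc, Int.ceil_le, Int.le_floor, hc]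
    constructor <;> linarith
  · intro n hn n' hn' h
    simp only [Finset.coe_filter, Finset.mem_Ioc, Set.mem_ofPred_eq] at hn hn'
    have hdvd : (q : ℤ) ∣ p * ((n : ℤ) - n') :=
      ⟨⌊(n : ℝ) * θ⌋ - ⌊(n' : ℝ) * θ⌋, by simp only at h; linear_combination h⟩
    have hcop : IsCoprime (q : ℤ) p := by
      rw [Int.isCoprime_iff_nat_coprime]
      simpa using r.reduced.symm
    have hlt : |(n : ℤ) - n'| < q := by
      rw [abs_lt]
      omega
    have := Int.eq_zero_of_abs_lt_dvd (hcop.dvd_of_dvd_mul_left hdvd) hlt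
    omega

lemma abs_card_block_fract_lt_sub_le {θ : ℝ} {r : ℚ}
    (hr : |(r.den : ℝ) * θ - r.num| * r.den ≤ 1) (m : ℕ) {x : ℝ} (hx : x ∈ Set.Icc (0 : ℝ) 1) :
    |(((Finset.Ioc m (m + r.den)).filter fun n : ℕ => Int.fract ((n : ℝ) * θ) < x).card : ℝ) -
      r.den * x| ≤ 3 := by
  have h1 := card_block_fract_mem_le hr m hx.1
  have h2 := card_block_fract_mem_le hr m hx.2
  simp only [Int.fract_nonneg, true_and, Int.fract_lt_one, and_true] at h1 h2
  simp only [← not_lt (b := x)] at h2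
  have h3 := Finset.card_filter_add_card_filter_not (s := Finset.Ioc m (m + r.den))
    (fun n : ℕ => Int.fract ((n : ℝ) * θ) < x)
  rw [Nat.card_Ioc, Nat.add_sub_cancel_left] at h3
  have h4 : ((((Finset.Ioc m (m + r.den)).filter fun n : ℕ =>
      Int.fract ((n : ℝ) * θ) < x).card : ℝ)) +
      (((Finset.Ioc m (m + r.den)).filter fun n : ℕ =>
      ¬ Int.fract ((n : ℝ) * θ) < x).card : ℝ) = r.den := by
    exact_mod_cast h3
  rw [abs_le]
  constructor <;> linarith

lemma fractCount_add (θ : ℝ) (m q : ℕ) (x : ℝ) :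
    fractCount θ (m + q) x = fractCount θ m x +
      ((Finset.Ioc m (m + q)).filter fun n : ℕ => Int.fract ((n : ℝ) * θ) < x).card := by
  rw [fractCount_eq_card, fractCount_eq_card,
    ← Finset.Ioc_union_Ioc_eq_Ioc (Nat.zero_le m) (Nat.le_add_right m q), Finset.filter_union,
    Finset.card_union_of_disjoint]
  exact Finset.disjoint_filter_filter (Finset.Ioc_disjoint_Ioc_of_le le_rfl)

lemma abs_fractCount_add_mul_den_sub_le {θ : ℝ} {r : ℚ}
    (hr : |(r.den : ℝ) * θ - r.num| * r.den ≤ 1) (m k : ℕ) {x : ℝ}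
    (hx : x ∈ Set.Icc (0 : ℝ) 1) :
    |(fractCount θ (m + k * r.den) x : ℝ) - ((m + k * r.den : ℕ) : ℝ) * x| ≤
      |(fractCount θ m x : ℝ) - m * x| + 3 * k := by
  induction k with
  | zero => simp
  | succ k ih =>
    have hb := abs_card_block_fract_lt_sub_le hr (m + k * r.den) hx
    have hs : m + (k + 1) * r.den = (m + k * r.den) + r.den := by ring
    rw [hs, fractCount_add]
    push_cast at ih ⊢
    rw [abs_le] at ih hb ⊢
    constructor <;> linarith [ih.1, ih.2, hb.1, hb.2]

/-- A Dirichlet approximation of quality `N` to a number of type `τ` has a large denominator. -/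
lemma natCast_div_den_le {τ θ c' : ℝ} (hτ : 0 < τ) (hc' : 0 < c')
    (hθ : ∀ (p : ℤ) (q : ℕ), 0 < q →
      |θ - (p : ℝ) / (q : ℝ)| > c' / (q : ℝ) ^ ((2 : ℝ) + τ))
    {N : ℕ} (hN : 1 ≤ N) {r : ℚ} (hr : |θ - r| ≤ 1 / ((N + 1) * r.den)) :
    (N : ℝ) / r.den ≤ c' ^ (-(1 / (τ + 1))) * (N : ℝ) ^ (τ / (τ + 1)) := by
  have hq0 : (0 : ℝ) < r.den := by exact_mod_cast r.den_pos
  have hN0 : (0 : ℝ) < N := by exact_mod_cast hN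
  have h1 : c' / (r.den : ℝ) ^ ((2 : ℝ) + τ) < 1 / ((N + 1) * r.den) := by
    have := hθ r.num r.den r.den_pos
    rw [← Rat.cast_def] at this
    exact this.trans_le hr
  have hpow : (r.den : ℝ) ^ ((2 : ℝ) + τ) = (r.den : ℝ) ^ (τ + 1) * r.den := by
    rw [← Real.rpow_add_one hq0.ne']
    ring_nf
  have hqp : 0 < (r.den : ℝ) ^ (τ + 1) := by positivity
  have h2 : c' * N ≤ (r.den : ℝ) ^ (τ + 1) := by
    rw [hpow, div_lt_div_iff₀ (by positivity) (by positivity)] at h1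
    have h3 : c' * (N + 1) < (r.den : ℝ) ^ (τ + 1) := by
      refine lt_of_mul_lt_mul_right ?_ hq0.le
      linarith
    linarith
  have h4 : (c' * N) ^ (1 / (τ + 1)) ≤ (r.den : ℝ) := by
    have := Real.rpow_le_rpow (by positivity) h2 (show 0 ≤ 1 / (τ + 1) by positivity)
    rwa [← Real.rpow_mul hq0.le, mul_one_div_cancel (by positivity), Real.rpow_one] at this
  calc (N : ℝ) / r.den ≤ N / (c' * N) ^ (1 / (τ + 1)) := by gcongr
    _ = c' ^ (-(1 / (τ + 1))) * (N : ℝ) ^ (τ / (τ + 1)) := by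
      have h5 : τ / (τ + 1) = 1 - 1 / (τ + 1) := by field_simp; ring
      rw [h5, Real.mul_rpow hc'.le hN0.le, Real.rpow_sub hN0, Real.rpow_one,
        Real.rpow_neg hc'.le]
      field_simp

/-- If `τ > 0` and `|θ - p/q| > c'/q^{2+τ}` for all integers `p` and positive integers
`q`, then the discrepancy of `({nθ})` satisfies `D_N({nθ}) ≤ C N^{τ/(τ+1)}`. -/
theorem one_dim_discrepancy_polynomial_type
    (τ : ℝ) (hτ : 0 < τ) (θ : ℝ) (c' : ℝ) (hc' : 0 < c')
    (hθ : ∀ (p : ℤ) (q : ℕ), 0 < q →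
      |θ - (p : ℝ) / (q : ℝ)| > c' / (q : ℝ) ^ ((2 : ℝ) + τ)) :
    ∃ C : ℝ, 0 < C ∧ ∀ N : ℕ, 1 ≤ N → ∀ x ∈ Set.Icc (0:ℝ) 1,
      |(fractCount θ N x : ℝ) - (N : ℝ) * x| ≤ C * (N : ℝ) ^ (τ / (τ + 1)) := by
  set α := τ / (τ + 1) with hα
  have hα0 : 0 < α := by positivity
  set A := c' ^ (-(1 / (τ + 1))) with hA
  have hA0 : 0 < A := by positivity
  set ρ : ℝ := (1 / 2 : ℝ) ^ α with hρ
  have hρ1 : ρ < 1 := Real.rpow_lt_one (by norm_num) (by norm_num) hα0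
  have hρ2 : 0 < 1 - ρ := by linarith
  set C := 3 * A / (1 - ρ) with hC
  have hC0 : 0 < C := by positivity
  have hCρ : 3 * A + C * ρ = C := by
    rw [hC]
    field_simp
    ring
  refine ⟨C, hC0, fun N hN x hx => ?_⟩
  clear hN
  induction N using Nat.strong_induction_on with
  | _ N ih =>
    rcases Nat.eq_zero_or_pos N with rfl | hN
    · simp [fractCount_eq_card, Real.zero_rpow hα0.ne']
    obtain ⟨r, hr, hrN⟩ := Real.exists_rat_abs_sub_le_and_den_le θ hN
    have hq0 : (0 : ℝ) < r.den := by exact_mod_cast r.den_pos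
    have hrN' : (r.den : ℝ) ≤ N := by exact_mod_cast hrN
    have happrox : |(r.den : ℝ) * θ - r.num| * r.den ≤ 1 := by
      have h1 : (r.den : ℝ) * θ - r.num = r.den * (θ - r) := by
        rw [Rat.cast_def r]
        field_simp
      rw [h1, abs_mul, abs_of_pos hq0]
      rw [le_div_iff₀ (by positivity)] at hr
      have h2 : |θ - r| * (r.den * r.den) ≤ |θ - r| * ((N + 1) * r.den) := by
        gcongr
        linarith
      linarith
    have hdecomp : N % r.den + N / r.den * r.den = N := by
      rw [mul_comm]
      exact Nat.mod_add_div N r.den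
    have hstep := abs_fractCount_add_mul_den_sub_le happrox (N % r.den) (N / r.den) hx
    rw [hdecomp] at hstep
    have hmod := Nat.mod_lt N r.den_pos
    have hhalf : ((N % r.den : ℕ) : ℝ) ≤ 1 / 2 * N := by
      have h1 : r.den ≤ N / r.den * r.den :=
        Nat.le_mul_of_pos_left _ (Nat.div_pos hrN r.den_pos)
      have h2 : 2 * (N % r.den) ≤ N := by omega
      have h3 : (2 : ℝ) * ((N % r.den : ℕ) : ℝ) ≤ N := by exact_mod_cast h2
      linarith
    have hrem : C * ((N % r.den : ℕ) : ℝ) ^ α ≤ C * (ρ * (N : ℝ) ^ α) := by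
      rw [hρ, ← Real.mul_rpow (by norm_num) (Nat.cast_nonneg N)]
      gcongr
    have hquot : ((N / r.den : ℕ) : ℝ) ≤ A * (N : ℝ) ^ α :=
      Nat.cast_div_le.trans (natCast_div_den_le hτ hc' hθ hN hr)
    calc |(fractCount θ N x : ℝ) - N * x|
        ≤ C * (ρ * (N : ℝ) ^ α) + 3 * (A * (N : ℝ) ^ α) := by
          have := ih (N % r.den) (hmod.trans_le hrN)
          linarith
      _ = (3 * A + C * ρ) * (N : ℝ) ^ α := by ring
      _ = C * (N : ℝ) ^ α := by rw [hCρ]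

end
end

section
/- Let 0 ≤ d < 1, set τ = 2/(1−d)² − 2, fix ε > 0, and let Ω ⊆ (0, π/2) and α ∈ [0, π/2], c > 0 be such that |tan(α − θ) − p/q| > c·q^{−2−τ−ε} for all θ ∈ Ω ∪ {0} ∪ (Ω + π/2) ∪ {π/2}, all integers p and positive integers q. For N ≥ 2 let V be the square [0, N^{1/2})² rotated counterclockwise by α, and let A_{Ω,α} be the family of rectangles R ⊆ V one of whose sides is either parallel to a side of V or makes angle θ − α with the x-axis for some θ ∈ Ω. Then there is a constant C (independent of N and R) such that for every R ∈ A_{Ω,α}, |#(ℤ² ∩ R) − area(R)| ≤ C·N^{(τ+ε)/(2(τ+ε+1))}. -/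
open MeasureTheory

noncomputable section

/-- Rotation of the plane by angle `φ`. -/
def rot (φ : ℝ) (x : ℝ × ℝ) : ℝ × ℝ :=
  (x.1 * Real.cos φ - x.2 * Real.sin φ, x.1 * Real.sin φ + x.2 * Real.cos φ)

/-- The rectangle obtained by rotating `[0,w] × [0,h]` by angle `φ` and translating by `p`. -/
def rect (φ : ℝ) (p : ℝ × ℝ) (w h : ℝ) : Set (ℝ × ℝ) :=
  (fun x => p + rot φ x) '' (Set.Icc 0 w ×ˢ Set.Icc 0 h)

/-- The square `[0, N^{1/2})²` rotated counterclockwise by `α`. -/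
def Vsq (α : ℝ) (N : ℕ) : Set (ℝ × ℝ) :=
  rot α '' (Set.Ico 0 (Real.sqrt N) ×ˢ Set.Ico 0 (Real.sqrt N))

/-- The integer lattice `ℤ²` viewed as a subset of `ℝ²`. -/
def lattice : Set (ℝ × ℝ) := {x | ∃ m n : ℤ, x = ((m : ℝ), (n : ℝ))}

/-- `t` is badly approximable up to exponent `2 + σ`, with constant `c`. -/
def IsDiophantine (c σ t : ℝ) : Prop :=
  ∀ (p : ℤ) (q : ℕ), 0 < q → c * (q : ℝ) ^ (-2 - σ) < |t - (p : ℝ) / (q : ℝ)|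

lemma IsDiophantine.neg {c σ t : ℝ} (ht : IsDiophantine c σ t) : IsDiophantine c σ (-t) := by
  intro p q hq
  have h := ht (-p) q hq
  rw [← abs_neg] at h
  convert h using 2
  push_cast
  ring

lemma IsDiophantine.lt_abs {c σ t : ℝ} (ht : IsDiophantine c σ t) : c < |t| := by
  simpa using ht 0 1 one_pos

lemma sum_range_int_emod_eq (p m : ℤ) (q : ℕ) (hq : 0 < q) (hpq : IsCoprime p (q : ℤ)) :
    ∑ n ∈ Finset.range q, (p * n + m) % (q : ℤ) = ∑ n ∈ Finset.range q, (n : ℤ) := by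
  have hq' : (0 : ℤ) < q := by exact_mod_cast hq
  have hnn : ∀ n : ℕ, 0 ≤ (p * n + m) % (q : ℤ) := fun n => Int.emod_nonneg _ hq'.ne'
  have hlt : ∀ n : ℕ, (p * n + m) % (q : ℤ) < q := fun n => Int.emod_lt_of_pos _ hq'
  have hmaps : ∀ n ∈ Finset.range q, ((p * n + m) % (q : ℤ)).toNat ∈ Finset.range q := by
    intro n _
    have h1 := hnn n
    have h2 := hlt n
    simp only [Finset.mem_range]
    omega
  have hinj : Set.InjOn (fun n : ℕ => ((p * n + m) % (q : ℤ)).toNat) (Finset.range q) := by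
    intro a ha b hb hab
    simp only [Finset.coe_range, Set.mem_Iio] at ha hb
    have h1 := hnn a
    have h2 := hnn b
    have hab' : (p * a + m) % (q : ℤ) = (p * b + m) % (q : ℤ) := by
      simp only at hab
      omega
    have hdvd : (q : ℤ) ∣ p * ((a : ℤ) - b) := by
      have := Int.ModEq.dvd (show (p * b + m) ≡ (p * a + m) [ZMOD q] from hab'.symm)
      convert this using 1
      ring
    have hdvd' : (q : ℤ) ∣ (a : ℤ) - b := hpq.symm.dvd_of_dvd_mul_left hdvd
    have := Int.eq_zero_of_abs_lt_dvd hdvd' (by rw [abs_lt]; omega)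
    omega
  refine Finset.sum_bij (fun n _ => ((p * n + m) % (q : ℤ)).toNat) hmaps
    (fun a ha b hb hab => hinj ha hb hab) ?_ (fun n _ => ?_)
  · intro b hb
    obtain ⟨a, ha, hab⟩ := Finset.surj_on_of_inj_on_of_card_le
      (fun (n : ℕ) _ => ((p * n + m) % (q : ℤ)).toNat) hmaps
      (fun a b ha hb hab => hinj ha hb hab) le_rfl b hb
    exact ⟨a, ha, hab.symm⟩
  · exact (Int.toNat_of_nonneg (hnn n)).symm

lemma sum_range_cast_real (q : ℕ) : ∑ n ∈ Finset.range q, (n : ℝ) = q * (q - 1) / 2 := by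
  induction q with
  | zero => simp
  | succ k ih => rw [Finset.sum_range_succ, ih]; push_cast; ring

/-- A form of Hermite's identity. -/
lemma sum_range_floor_rat_mul_add (p : ℤ) (q : ℕ) (hq : 0 < q) (hpq : IsCoprime p (q : ℤ))
    (x : ℝ) :
    ∑ n ∈ Finset.range q, (⌊(p : ℝ) / q * n + x⌋ : ℝ)
      = p * (q - 1) / 2 + ⌊q * x⌋ - (q - 1) / 2 := by
  have hq' : (0 : ℝ) < q := by exact_mod_cast hq
  set m := ⌊(q : ℝ) * x⌋ with hm
  have hfl : ∀ n : ℕ, ⌊(p : ℝ) / q * n + x⌋ = (p * n + m) / (q : ℤ) := by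
    intro n
    have : (p : ℝ) / q * n + x = (((p * n : ℤ) : ℝ) + q * x) / q := by
      push_cast
      field_simp
    rw [this, Int.floor_div_natCast, Int.floor_intCast_add]
  have hmod := sum_range_int_emod_eq p m q hq hpq
  have hmodR : ∑ n ∈ Finset.range q, (((p * n + m) % (q : ℤ) : ℤ) : ℝ)
      = q * (q - 1) / 2 := by
    rw [← sum_range_cast_real]
    rw [← Int.cast_sum, hmod]
    push_cast
    rfl
  have hterm : ∀ n : ℕ, (q : ℝ) * (⌊(p : ℝ) / q * n + x⌋ : ℝ)
      = p * n + m - (((p * n + m) % (q : ℤ) : ℤ) : ℝ) := by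
    intro n
    rw [hfl]
    have := Int.emod_add_mul_ediv (p * n + m) q
    have h2 : (((p * n + m) % (q : ℤ) : ℤ) : ℝ) + q * (((p * n + m) / (q : ℤ) : ℤ) : ℝ)
        = p * n + m := by exact_mod_cast this
    linarith
  have hsum : (q : ℝ) * ∑ n ∈ Finset.range q, (⌊(p : ℝ) / q * n + x⌋ : ℝ)
      = q * (p * (q - 1) / 2 + m - (q - 1) / 2) := by
    rw [Finset.mul_sum, Finset.sum_congr rfl (fun n _ => hterm n), Finset.sum_sub_distrib, hmodR,
      Finset.sum_add_distrib, ← Finset.mul_sum, sum_range_cast_real]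
    simp
    ring
  have hq_ne : (q : ℝ) ≠ 0 := by positivity
  exact mul_left_cancel₀ hq_ne hsum

/-- The sum of the sawtooth `⌊x⌋ - x + 1/2` along the progression `b, t + b, …`. -/
def sawtoothSum (t b : ℝ) (M : ℕ) : ℝ :=
  ∑ n ∈ Finset.range M, ((⌊t * n + b⌋ : ℝ) - (t * n + b) + 1 / 2)

lemma sawtoothSum_add (t b : ℝ) (M L : ℕ) :
    sawtoothSum t b (M + L) = sawtoothSum t b M + sawtoothSum t (t * M + b) L := by
  unfold sawtoothSum
  rw [Finset.sum_range_add]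
  congr 1
  refine Finset.sum_congr rfl fun n _ => ?_
  have : t * ((M + n : ℕ) : ℝ) + b = t * n + (t * M + b) := by push_cast; ring
  rw [this]

lemma abs_sawtoothSum_le_two (t b : ℝ) (p : ℤ) (q : ℕ) (hq : 0 < q)
    (hpq : IsCoprime p (q : ℤ)) (ht : |t - (p : ℝ) / q| ≤ 1 / ((q : ℝ) * q)) :
    |sawtoothSum t b q| ≤ 2 := by
  have hq' : (0 : ℝ) < q := by exact_mod_cast hq
  have hq1 : (1 : ℝ) ≤ q := by exact_mod_cast hq
  have hdev : ∀ n ∈ Finset.range q, |t * n - (p : ℝ) / q * n| ≤ 1 / q := by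
    intro n hn
    have hn' : (n : ℝ) ≤ q := by exact_mod_cast (Finset.mem_range.1 hn).le
    rw [← sub_mul, abs_mul, abs_of_nonneg (Nat.cast_nonneg n : (0 : ℝ) ≤ n)]
    calc |t - (p : ℝ) / q| * n ≤ 1 / ((q : ℝ) * q) * q := by gcongr
      _ = 1 / q := by field_simp
  have hup : ∑ n ∈ Finset.range q, (⌊t * n + b⌋ : ℝ)
      ≤ ∑ n ∈ Finset.range q, (⌊(p : ℝ) / q * n + (b + 1 / q)⌋ : ℝ) := by
    refine Finset.sum_le_sum fun n hn => ?_
    have h := (abs_le.1 (hdev n hn)).2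
    exact Int.cast_le.2 (Int.floor_le_floor (by linarith))
  have hlo : ∑ n ∈ Finset.range q, (⌊(p : ℝ) / q * n + (b - 1 / q)⌋ : ℝ)
      ≤ ∑ n ∈ Finset.range q, (⌊t * n + b⌋ : ℝ) := by
    refine Finset.sum_le_sum fun n hn => ?_
    have h := (abs_le.1 (hdev n hn)).1
    exact Int.cast_le.2 (Int.floor_le_floor (by linarith))
  rw [sum_range_floor_rat_mul_add p q hq hpq] at hup hlo
  have e1 : (q : ℝ) * (b + 1 / q) = q * b + 1 := by field_simp
  have e2 : (q : ℝ) * (b - 1 / q) = q * b - 1 := by field_simp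
  rw [e1] at hup
  rw [e2] at hlo
  have f1 := Int.floor_le ((q : ℝ) * b + 1)
  have f2 := Int.lt_floor_add_one ((q : ℝ) * b - 1)
  have hslope : |t * (q * (q - 1) / 2) - p * (q - 1) / 2| ≤ 1 / 2 := by
    have : t * (q * (q - 1) / 2) - p * (q - 1) / 2 = (t - (p : ℝ) / q) * (q * (q - 1) / 2) := by
      field_simp
    rw [this, abs_mul, abs_of_nonneg (by nlinarith : (0 : ℝ) ≤ q * (q - 1) / 2)]
    calc |t - (p : ℝ) / q| * (q * (q - 1) / 2) ≤ 1 / ((q : ℝ) * q) * (q * q / 2) := by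
          gcongr
          linarith
      _ = 1 / 2 := by field_simp
  have hS : sawtoothSum t b q = ∑ n ∈ Finset.range q, (⌊t * n + b⌋ : ℝ)
      - (t * (q * (q - 1) / 2) + q * b) + q / 2 := by
    unfold sawtoothSum
    rw [Finset.sum_add_distrib, Finset.sum_sub_distrib, Finset.sum_add_distrib, ← Finset.mul_sum,
      sum_range_cast_real]
    simp
    ring
  obtain ⟨s1, s2⟩ := abs_le.1 hslope
  rw [hS, abs_le]
  constructor <;> linarith

lemma abs_sawtoothSum_mul_le (t b : ℝ) (p : ℤ) (q k : ℕ) (hq : 0 < q)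
    (hpq : IsCoprime p (q : ℤ)) (ht : |t - (p : ℝ) / q| ≤ 1 / ((q : ℝ) * q)) :
    |sawtoothSum t b (q * k)| ≤ 2 * k := by
  induction k with
  | zero => simp [sawtoothSum]
  | succ k ih =>
    rw [Nat.mul_succ, sawtoothSum_add]
    have h := abs_sawtoothSum_le_two t (t * (q * k : ℕ) + b) p q hq hpq ht
    push_cast at h ⊢
    refine (abs_add_le _ _).trans ?_
    linarith

lemma IsDiophantine.div_le {c σ t : ℝ} (hc : 0 < c) (hσ : 0 < σ) (ht : IsDiophantine c σ t)
    (M q : ℕ) (p : ℤ) (hM : 0 < M) (hq : 0 < q)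
    (hp : |t - (p : ℝ) / q| ≤ 1 / (((M : ℝ) + 1) * q)) :
    (M : ℝ) / q ≤ c ^ (-(1 / (1 + σ))) * (M : ℝ) ^ (σ / (1 + σ)) := by
  have hq' : (0 : ℝ) < q := by exact_mod_cast hq
  have hM' : (0 : ℝ) < M := by exact_mod_cast hM
  have h1 := (ht p q hq).trans_le hp
  have h2 : c * M ≤ (q : ℝ) ^ (1 + σ) := by
    have e : (q : ℝ) ^ (-2 - σ) = ((q : ℝ) ^ (1 + σ) * q)⁻¹ := by
      rw [← Real.rpow_add_one hq'.ne', ← Real.rpow_neg hq'.le]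
      congr 1
      ring
    have hpos : (0 : ℝ) < (q : ℝ) ^ (1 + σ) := Real.rpow_pos_of_pos hq' _
    rw [e, ← div_eq_mul_inv, div_lt_div_iff₀ (by positivity) (by positivity)] at h1
    have h3 : c * ((M : ℝ) + 1) < (q : ℝ) ^ (1 + σ) := by
      by_contra! hcon
      have := mul_le_mul_of_nonneg_right hcon hq'.le
      linarith
    nlinarith
  have h4 : c ^ (1 / (1 + σ)) * (M : ℝ) ^ (1 / (1 + σ)) ≤ q := by
    rw [← Real.mul_rpow hc.le hM'.le]
    calc (c * M) ^ (1 / (1 + σ)) ≤ ((q : ℝ) ^ (1 + σ)) ^ (1 / (1 + σ)) := by gcongr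
      _ = q := by
        rw [← Real.rpow_mul hq'.le, mul_one_div_cancel (by positivity), Real.rpow_one]
  rw [div_le_iff₀ hq']
  have hcp : c ^ (-(1 / (1 + σ))) * c ^ (1 / (1 + σ)) = 1 := by
    rw [← Real.rpow_add hc]; simp
  have hMp : (M : ℝ) ^ (σ / (1 + σ)) * (M : ℝ) ^ (1 / (1 + σ)) = M := by
    rw [← Real.rpow_add hM', ← add_div, add_comm σ 1, div_self (by positivity), Real.rpow_one]
  calc (M : ℝ) = (c ^ (-(1 / (1 + σ))) * (M : ℝ) ^ (σ / (1 + σ)))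
        * (c ^ (1 / (1 + σ)) * (M : ℝ) ^ (1 / (1 + σ))) := by
        linear_combination (-(M : ℝ)) * hcp - (c ^ (-(1 / (1 + σ))) * c ^ (1 / (1 + σ))) * hMp
    _ ≤ _ := by gcongr

lemma exists_sawtoothSum_bound {c σ : ℝ} (hc : 0 < c) (hσ : 0 < σ) :
    ∃ K : ℝ, 0 < K ∧ ∀ t, IsDiophantine c σ t → ∀ (M : ℕ) (b : ℝ),
      |sawtoothSum t b M| ≤ K * (M : ℝ) ^ (σ / (1 + σ)) := by
  set β := σ / (1 + σ) with hβ
  have hβ0 : 0 < β := by positivity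
  set c' := c ^ (-(1 / (1 + σ))) with hc'
  have hc'0 : 0 < c' := Real.rpow_pos_of_pos hc _
  have hlam : ((1 : ℝ) / 2) ^ β < 1 := Real.rpow_lt_one (by norm_num) (by norm_num) hβ0
  set lam := ((1 : ℝ) / 2) ^ β
  refine ⟨2 * c' / (1 - lam), div_pos (by positivity) (by linarith), fun t ht M => ?_⟩
  set K := 2 * c' / (1 - lam) with hK
  have hK0 : 0 < K := div_pos (by positivity) (by linarith)
  have hKeq : 2 * c' + K * lam = K := by
    rw [hK]
    field_simp [show (1 - lam) ≠ 0 by linarith]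
    ring
  induction M using Nat.strong_induction_on with
  | _ M ih =>
  intro b
  rcases Nat.eq_zero_or_pos M with rfl | hM
  · simp [sawtoothSum, Real.zero_rpow hβ0.ne']
  obtain ⟨r, hr, hrM⟩ := Real.exists_rat_abs_sub_le_and_den_le t hM
  have hq : 0 < r.den := r.pos
  have hq' : (0 : ℝ) < r.den := by exact_mod_cast hq
  have hqM : (r.den : ℝ) ≤ M := by exact_mod_cast hrM
  have hM' : (0 : ℝ) < M := by exact_mod_cast hM
  have hcast : (r : ℝ) = (r.num : ℝ) / r.den := Rat.cast_def r
  rw [hcast] at hr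
  have hcop : IsCoprime r.num (r.den : ℤ) :=
    Int.isCoprime_iff_nat_coprime.2 (by simpa using r.reduced)
  have hdiv := ht.div_le hc hσ M r.den r.num hM hq hr
  have hmod : M % r.den < M := (Nat.mod_lt M hq).trans_le hrM
  have hsmall : ((M % r.den : ℕ) : ℝ) ≤ 1 / 2 * M := by
    have h1 : M % r.den < r.den := Nat.mod_lt M hq
    have h2 := Nat.div_add_mod M r.den
    have h3 : 1 ≤ M / r.den := Nat.div_pos hrM hq
    have h4 : r.den * 1 ≤ r.den * (M / r.den) := Nat.mul_le_mul_left _ h3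
    have h5 : 2 * (M % r.den) ≤ M := by omega
    have : (2 : ℝ) * ((M % r.den : ℕ) : ℝ) ≤ M := by exact_mod_cast h5
    linarith
  have hblocks := abs_sawtoothSum_mul_le t b r.num r.den (M / r.den) hq hcop (hr.trans (by
    gcongr
    linarith))
  have hrest := ih (M % r.den) hmod (t * ((r.den * (M / r.den) : ℕ) : ℝ) + b)
  have hsplit := sawtoothSum_add t b (r.den * (M / r.den)) (M % r.den)
  rw [Nat.div_add_mod] at hsplit
  have hk : ((M / r.den : ℕ) : ℝ) ≤ M / r.den := Nat.cast_div_le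
  calc |sawtoothSum t b M| ≤ 2 * ((M / r.den : ℕ) : ℝ) + K * ((M % r.den : ℕ) : ℝ) ^ β := by
        rw [hsplit]
        exact (abs_add_le _ _).trans (add_le_add hblocks hrest)
    _ ≤ 2 * (c' * (M : ℝ) ^ β) + K * (1 / 2 * (M : ℝ)) ^ β := by
        gcongr
        exact hk.trans hdiv
    _ = K * (M : ℝ) ^ β := by
        rw [Real.mul_rpow (by norm_num) hM'.le]
        linear_combination (M : ℝ) ^ β * hKeq

/-- Lattice points whose coordinates in the frame `(C, S), (-S, C)` lie in `I` and `J`. -/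
def tiltedPoints (C S : ℝ) (I J : Set ℝ) : Set (ℤ × ℤ) :=
  {z | z.1 * C + z.2 * S ∈ I ∧ -(z.1 * S) + z.2 * C ∈ J}

/-- Lattice points of the strip `a < x * C + y * S ≤ a + s` in `M` consecutive columns. -/
def stripColumns (C S a s : ℝ) (m₀ : ℤ) (M : ℕ) : Set (ℤ × ℤ) :=
  {z | (m₀ ≤ z.1 ∧ z.1 < m₀ + M) ∧ z.1 * C + z.2 * S ∈ Set.Ioc a (a + s)}

lemma stripColumns_finite_and_ncard {C S a s : ℝ} (hS : 0 < S) (hs : 0 ≤ s) (m₀ : ℤ) (M : ℕ) :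
    (stripColumns C S a s m₀ M).Finite ∧
    ((stripColumns C S a s m₀ M).ncard : ℝ) = M * (s / S)
      + sawtoothSum (-C / S) (-C / S * m₀ + (a + s) / S) M
      - sawtoothSum (-C / S) (-C / S * m₀ + a / S) M := by
  set t := -C / S with ht
  set lo : ℕ → ℤ := fun j => ⌊t * j + (t * m₀ + a / S)⌋ with hlo
  set hi : ℕ → ℤ := fun j => ⌊t * j + (t * m₀ + (a + s) / S)⌋ with hhi
  have hlohi : ∀ j, lo j ≤ hi j := fun j => Int.floor_le_floor (by gcongr; linarith)
  set F : Finset (ℤ × ℤ) := ((Finset.range M).sigma fun j => Finset.Ioc (lo j) (hi j)).image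
    (fun x : Σ _ : ℕ, ℤ => (m₀ + x.1, x.2)) with hF
  have hiff : ∀ (j : ℕ) (n : ℤ), n ∈ Finset.Ioc (lo j) (hi j) ↔
      ((m₀ + j : ℤ) : ℝ) * C + n * S ∈ Set.Ioc a (a + s) := by
    intro j n
    rw [Finset.mem_Ioc, Set.mem_Ioc, hlo, hhi]
    simp only
    rw [Int.floor_lt, Int.le_floor]
    have e1 : t * j + (t * m₀ + a / S) = (a - (m₀ + j) * C) / S := by
      rw [ht]; field_simp; ring
    have e2 : t * j + (t * m₀ + (a + s) / S) = (a + s - (m₀ + j) * C) / S := by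
      rw [ht]; field_simp; ring
    rw [e1, e2, div_lt_iff₀ hS, le_div_iff₀ hS]
    push_cast
    constructor <;> rintro ⟨h1, h2⟩ <;> constructor <;> linarith
  have hset : stripColumns C S a s m₀ M = (F : Set (ℤ × ℤ)) := by
    ext ⟨m, n⟩
    simp only [stripColumns, Set.mem_ofPred_eq, hF, Finset.coe_image, Set.mem_image,
      Finset.mem_coe, Finset.mem_sigma, Finset.mem_range, Prod.mk.injEq]
    constructor
    · rintro ⟨⟨h1, h2⟩, h3⟩
      have e : m₀ + ((m - m₀).toNat : ℤ) = m := by omega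
      refine ⟨⟨(m - m₀).toNat, n⟩, ⟨by simp only; omega, (hiff _ _).2 ?_⟩, e, rfl⟩
      rw [e]
      exact h3
    · rintro ⟨⟨j, k⟩, ⟨h1, h2⟩, rfl, rfl⟩
      simp only at h1 h2 ⊢
      exact ⟨⟨by omega, by omega⟩, (hiff _ _).1 h2⟩
  have hinj : Function.Injective (fun x : Σ _ : ℕ, ℤ => (m₀ + (x.1 : ℤ), x.2)) := by
    rintro ⟨j, n⟩ ⟨j', n'⟩ h
    simp only [Prod.mk.injEq] at h
    obtain ⟨h1, rfl⟩ := h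
    obtain rfl : j = j' := by omega
    rfl
  refine ⟨hset ▸ F.finite_toSet, ?_⟩
  rw [hset, Set.ncard_coe_finset, hF, Finset.card_image_of_injective _ hinj, Finset.card_sigma]
  unfold sawtoothSum
  have hterm : ∀ j, ((Finset.Ioc (lo j) (hi j)).card : ℝ) = s / S
      + ((⌊t * j + (t * m₀ + (a + s) / S)⌋ : ℝ) - (t * j + (t * m₀ + (a + s) / S)) + 1 / 2)
      - ((⌊t * j + (t * m₀ + a / S)⌋ : ℝ) - (t * j + (t * m₀ + a / S)) + 1 / 2) := by
    intro j
    have hc : (((Finset.Ioc (lo j) (hi j)).card : ℤ) : ℝ) = hi j - lo j := by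
      rw [Int.card_Ioc, Int.toNat_of_nonneg (by linarith [hlohi j])]
      push_cast
      rfl
    rw [Int.cast_natCast] at hc
    rw [hc]
    simp only [hlo, hhi]
    field_simp
    ring
  push_cast
  rw [Finset.sum_congr rfl fun j _ => hterm j, Finset.sum_sub_distrib, Finset.sum_add_distrib]
  simp

lemma tiltedPoints_finite (C S : ℝ) (hCS : C ^ 2 + S ^ 2 = 1) {I J : Set ℝ}
    (hI : Bornology.IsBounded I) (hJ : Bornology.IsBounded J) :
    (tiltedPoints C S I J).Finite := by
  obtain ⟨A, hA⟩ := hI.subset_closedBall 0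
  obtain ⟨B, hB⟩ := hJ.subset_closedBall 0
  have hC : |C| ≤ 1 := abs_le_one_iff_mul_self_le_one.2 (by nlinarith)
  have hS : |S| ≤ 1 := abs_le_one_iff_mul_self_le_one.2 (by nlinarith)
  have hbound : ∀ x y X Y : ℝ, |x| ≤ A → |y| ≤ B → |X| ≤ 1 → |Y| ≤ 1 →
      |x * X + y * Y| ≤ A + B := by
    intro x y X Y hx hy hX hY
    refine (abs_add_le _ _).trans ?_
    rw [abs_mul, abs_mul]
    have := abs_nonneg x
    have := abs_nonneg y
    nlinarith
  set L := ⌈A + B⌉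
  refine ((Set.finite_Icc (-L) L).prod (Set.finite_Icc (-L) L)).subset ?_
  rintro ⟨m, n⟩ ⟨hu, hv⟩
  have hu' := hA hu
  have hv' := hB hv
  simp only [Metric.mem_closedBall, Real.dist_eq, sub_zero] at hu' hv'
  have hm := hbound _ _ C (-S) hu' hv' hC (by rwa [abs_neg])
  have hn := hbound _ _ S C hu' hv' hS hC
  have em : (m * C + n * S) * C + (-(m * S) + n * C) * -S = (m : ℝ) := by
    linear_combination (m : ℝ) * hCS
  have en : (m * C + n * S) * S + (-(m * S) + n * C) * C = (n : ℝ) := by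
    linear_combination (n : ℝ) * hCS
  rw [em] at hm
  rw [en] at hn
  have hL : A + B ≤ (L : ℝ) := Int.le_ceil _
  have hm' := abs_le.1 (hm.trans hL)
  have hn' := abs_le.1 (hn.trans hL)
  refine ⟨⟨?_, ?_⟩, ?_, ?_⟩
  · exact_mod_cast hm'.1
  · exact_mod_cast hm'.2
  · exact_mod_cast hn'.1
  · exact_mod_cast hn'.2

lemma tiltedPoints_neg_frame (C S : ℝ) (I J : Set ℝ) :
    tiltedPoints C S I J = tiltedPoints (-C) (-S) (-I) (-J) := by
  ext ⟨m, n⟩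
  simp only [tiltedPoints, Set.mem_ofPred_eq, Set.mem_neg]
  ring_nf

lemma tiltedPoints_rotate_frame (C S : ℝ) (I J : Set ℝ) :
    tiltedPoints C S I J = tiltedPoints (-S) C J (-I) := by
  ext ⟨m, n⟩
  simp only [tiltedPoints, Set.mem_ofPred_eq, Set.mem_neg]
  rw [and_comm]
  ring_nf

lemma ncard_tiltedPoints_neg (C S : ℝ) (I J : Set ℝ) :
    (tiltedPoints C S I J).ncard = (tiltedPoints C S (-I) (-J)).ncard := by
  rw [← Set.ncard_image_of_injective _ (neg_injective (G := ℤ × ℤ))]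
  congr 1
  ext ⟨m, n⟩
  simp only [tiltedPoints, Set.mem_ofPred_eq, Set.mem_neg, Set.image_neg_eq_neg,
    Prod.neg_mk]
  push_cast
  ring_nf

/-- A thin rectangle with a long side of Diophantine slope contains about `s * h` points. -/
lemma abs_ncard_thin_sub_le {K β κ C S a s b h : ℝ} (hβ : 0 < β)
    (hK : ∀ (M : ℕ) (x : ℝ), |sawtoothSum (-C / S) x M| ≤ K * (M : ℝ) ^ β) (hK0 : 0 < K)
    (hCS : C ^ 2 + S ^ 2 = 1) (hκ : 0 < κ) (hS : κ ≤ S) (hs : 0 ≤ s) (hs2 : s ≤ 2) (hh : 0 ≤ h) :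
    |((tiltedPoints C S (Set.Ioc a (a + s)) (Set.Icc b (b + h))).ncard : ℝ) - s * h|
      ≤ 10 / κ + 2 * K * (h + 5) ^ β := by
  have hS0 : 0 < S := hκ.trans_le hS
  have hC1 := abs_le.1 (abs_le_one_iff_mul_self_le_one.2 (by nlinarith) : |C| ≤ 1)
  have hS1 := abs_le.1 (abs_le_one_iff_mul_self_le_one.2 (by nlinarith) : |S| ≤ 1)
  have hfin : (tiltedPoints C S (Set.Ioc a (a + s)) (Set.Icc b (b + h))).Finite :=
    tiltedPoints_finite C S hCS (Metric.isBounded_Ioc _ _) (Metric.isBounded_Icc _ _)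
  have hcols : ∀ (m₀ : ℤ) (M : ℕ), (M : ℝ) ≤ h + 5 →
      |((stripColumns C S a s m₀ M).ncard : ℝ) - M * (s / S)| ≤ 2 * K * (h + 5) ^ β := by
    intro m₀ M hM
    rw [(stripColumns_finite_and_ncard hS0 hs m₀ M).2]
    have h1 := abs_le.1 (hK M (-C / S * m₀ + (a + s) / S))
    have h2 := abs_le.1 (hK M (-C / S * m₀ + a / S))
    have h3 : K * (M : ℝ) ^ β ≤ K * (h + 5) ^ β := by gcongr
    rw [abs_le]
    constructor <;> linarith
  have hend : 5 * (s / S) ≤ 10 / κ := by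
    rw [← mul_div_assoc]
    gcongr
    linarith
  have hhS : h * S ≤ h := by nlinarith
  have hsS : 0 ≤ s / S := by positivity
  have hmain : h * S * (s / S) = s * h := by field_simp
  have huC : ∀ u, a < u → u ≤ a + s → a * C - 2 ≤ u * C ∧ u * C ≤ a * C + 2 := by
    intro u h1 h2
    constructor <;> nlinarith
  have hmu : ∀ m n : ℝ, m = (m * C + n * S) * C - (-(m * S) + n * C) * S := by
    intro m n
    linear_combination -m * hCS
  rw [abs_le]
  constructor
  · set m₀ := ⌈a * C - (b + h) * S + 2⌉ with hm₀
    set m₁ := ⌊a * C - b * S - 2⌋ with hm₁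
    set M := (m₁ - m₀ + 1).toNat with hM
    have c1 := Int.ceil_lt_add_one (a * C - (b + h) * S + 2)
    have c2 := Int.le_ceil (a * C - (b + h) * S + 2)
    have c3 := Int.floor_le (a * C - b * S - 2)
    have c4 := Int.lt_floor_add_one (a * C - b * S - 2)
    have hMle : (M : ℝ) ≤ h + 5 := by
      rcases le_total 0 (m₁ - m₀ + 1) with hp | hp
      · have : ((M : ℤ) : ℝ) = m₁ - m₀ + 1 := by
          rw [hM, Int.toNat_of_nonneg hp]; push_cast; ring
        rw [Int.cast_natCast] at this
        linarith
      · have : M = 0 := by omega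
        rw [this]; push_cast; linarith
    have hMge : h * S - 5 ≤ M := by
      have : m₁ - m₀ + 1 ≤ (M : ℤ) := Int.self_le_toNat _
      have : ((m₁ - m₀ + 1 : ℤ) : ℝ) ≤ M := by exact_mod_cast this
      push_cast at this
      linarith
    have hsub : stripColumns C S a s m₀ M ⊆
        tiltedPoints C S (Set.Ioc a (a + s)) (Set.Icc b (b + h)) := by
      rintro ⟨m, n⟩ ⟨⟨h1, h2⟩, h3⟩
      refine ⟨h3, ?_⟩
      simp only at h1 h2 h3 ⊢
      have h4 := huC _ h3.1 h3.2
      have h5 := hmu m n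
      have h6 : m ≤ m₁ := by omega
      have h1' : (m₀ : ℝ) ≤ m := by exact_mod_cast h1
      have h6' : (m : ℝ) ≤ m₁ := by exact_mod_cast h6
      constructor
      · refine le_of_mul_le_mul_right ?_ hS0
        linarith
      · refine le_of_mul_le_mul_right ?_ hS0
        linarith
    have hcard : ((stripColumns C S a s m₀ M).ncard : ℝ) ≤
        (tiltedPoints C S (Set.Ioc a (a + s)) (Set.Icc b (b + h))).ncard := by
      exact_mod_cast Set.ncard_le_ncard hsub hfin
    have h7 := (abs_le.1 (hcols m₀ M hMle)).1
    have h8 := mul_le_mul_of_nonneg_right hMge hsS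
    linarith
  · set m₀ := ⌈a * C - (b + h) * S - 2⌉ with hm₀
    set m₁ := ⌊a * C - b * S + 2⌋ with hm₁
    set M := (m₁ - m₀ + 1).toNat with hM
    have c1 := Int.ceil_lt_add_one (a * C - (b + h) * S - 2)
    have c2 := Int.le_ceil (a * C - (b + h) * S - 2)
    have c3 := Int.floor_le (a * C - b * S + 2)
    have c4 := Int.lt_floor_add_one (a * C - b * S + 2)
    have hhS0 : 0 ≤ h * S := by positivity
    have hp : 0 ≤ m₁ - m₀ + 1 := by
      have : (-1 : ℝ) < ((m₁ - m₀ + 1 : ℤ) : ℝ) := by push_cast; linarith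
      have : (-1 : ℤ) < m₁ - m₀ + 1 := by exact_mod_cast this
      omega
    have hMeq : (M : ℝ) = m₁ - m₀ + 1 := by
      have : ((M : ℤ) : ℝ) = m₁ - m₀ + 1 := by
        rw [hM, Int.toNat_of_nonneg hp]; push_cast; ring
      rwa [Int.cast_natCast] at this
    have hMle : (M : ℝ) ≤ h * S + 5 := by linarith
    have hsub : tiltedPoints C S (Set.Ioc a (a + s)) (Set.Icc b (b + h)) ⊆
        stripColumns C S a s m₀ M := by
      rintro ⟨m, n⟩ ⟨h3, h1, h2⟩
      refine ⟨?_, h3⟩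
      simp only at h1 h2 h3 ⊢
      have h4 := huC _ h3.1 h3.2
      have h5 := hmu m n
      have h1' := mul_le_mul_of_nonneg_right h1 hS0.le
      have h2' := mul_le_mul_of_nonneg_right h2 hS0.le
      have h6 : m₀ ≤ m := Int.ceil_le.2 (by linarith)
      have h7 : m ≤ m₁ := Int.le_floor.2 (by linarith)
      omega
    have hcard : ((tiltedPoints C S (Set.Ioc a (a + s)) (Set.Icc b (b + h))).ncard : ℝ) ≤
        (stripColumns C S a s m₀ M).ncard := by
      exact_mod_cast Set.ncard_le_ncard hsub (stripColumns_finite_and_ncard hS0 hs m₀ M).1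
    have h7 := (abs_le.1 (hcols m₀ M (by linarith))).2
    have h8 := mul_le_mul_of_nonneg_right hMle hsS
    linarith

/-- Translating a rectangle across its width by at most `2` changes the count little. -/
lemma abs_ncard_translate_sub_le {K β κ C S w b h : ℝ} (hβ : 0 < β)
    (hK : ∀ (M : ℕ) (x : ℝ), |sawtoothSum (-C / S) x M| ≤ K * (M : ℝ) ^ β) (hK0 : 0 < K)
    (hCS : C ^ 2 + S ^ 2 = 1) (hκ : 0 < κ) (hS : κ ≤ |S|) (hw : 0 ≤ w) (hh : 0 ≤ h)
    (a a' : ℝ) (haa' : |a' - a| ≤ 2) :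
    |((tiltedPoints C S (Set.Icc a' (a' + w)) (Set.Icc b (b + h))).ncard : ℝ)
      - (tiltedPoints C S (Set.Icc a (a + w)) (Set.Icc b (b + h))).ncard|
      ≤ 2 * (10 / κ + 2 * K * (h + 5) ^ β) := by
  set E := 10 / κ + 2 * K * (h + 5) ^ β with hE
  wlog hle : a ≤ a' generalizing a a'
  · rw [abs_sub_comm]
    exact this a' a (by rwa [abs_sub_comm]) (le_of_not_ge hle)
  set s := a' - a with hs
  have hs0 : 0 ≤ s := by linarith
  have hs2 : s ≤ 2 := (abs_le.1 haa').2
  have hthin : ∀ x, |((tiltedPoints C S (Set.Ioc x (x + s)) (Set.Icc b (b + h))).ncard : ℝ)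
        - s * h| ≤ E ∧
      |((tiltedPoints C S (Set.Ico x (x + s)) (Set.Icc b (b + h))).ncard : ℝ) - s * h| ≤ E := by
    intro x
    rcases le_total 0 S with hS0 | hS0
    · rw [abs_of_nonneg hS0] at hS
      refine ⟨abs_ncard_thin_sub_le hβ hK hK0 hCS hκ hS hs0 hs2 hh, ?_⟩
      rw [ncard_tiltedPoints_neg]
      have := abs_ncard_thin_sub_le (a := -(x + s)) (b := -(b + h)) hβ hK hK0 hCS hκ hS hs0 hs2 hh
      simpa using this
    · rw [abs_of_nonpos hS0] at hS
      have hK' : ∀ (M : ℕ) (y : ℝ), |sawtoothSum (-(-C) / (-S)) y M| ≤ K * (M : ℝ) ^ β := by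
        simpa [neg_div, div_neg] using hK
      have hCS' : (-C) ^ 2 + (-S) ^ 2 = 1 := by simpa using hCS
      constructor
      · rw [ncard_tiltedPoints_neg, tiltedPoints_neg_frame, neg_neg, neg_neg]
        exact abs_ncard_thin_sub_le hβ hK' hK0 hCS' hκ hS hs0 hs2 hh
      · rw [tiltedPoints_neg_frame]
        have := abs_ncard_thin_sub_le (a := -(x + s)) (b := -(b + h)) hβ hK' hK0 hCS' hκ hS hs0
          hs2 hh
        simpa using this
  have hfin : ∀ I, Bornology.IsBounded I → (tiltedPoints C S I (Set.Icc b (b + h))).Finite :=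
    fun I hI => tiltedPoints_finite C S hCS hI (Metric.isBounded_Icc _ _)
  have hsplit : ∀ I I' : Set ℝ, Bornology.IsBounded I → Bornology.IsBounded I' → Disjoint I I' →
      (tiltedPoints C S (I ∪ I') (Set.Icc b (b + h))).ncard
        = (tiltedPoints C S I (Set.Icc b (b + h))).ncard
          + (tiltedPoints C S I' (Set.Icc b (b + h))).ncard := by
    intro I I' hI hI' hd
    rw [← Set.ncard_union_eq _ (hfin I hI) (hfin I' hI')]
    · congr 1
      ext z
      simp only [tiltedPoints, Set.mem_union, Set.mem_ofPred_eq]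
      tauto
    · rw [Set.disjoint_left]
      exact fun z hz hz' => Set.disjoint_left.1 hd hz.1 hz'.1
  have hu1 : Set.Icc a (a + w) ∪ Set.Ioc (a + w) (a + w + s) = Set.Icc a (a' + w) := by
    rw [Set.Icc_union_Ioc_eq_Icc (by linarith) (by linarith)]
    congr 1
    rw [hs]; ring
  have hu2 : Set.Ico a (a + s) ∪ Set.Icc a' (a' + w) = Set.Icc a (a' + w) := by
    rw [show a + s = a' by rw [hs]; ring, Set.Ico_union_Icc_eq_Icc hle (by linarith)]
  have h1 := hsplit _ _ (Metric.isBounded_Icc a (a + w)) (Metric.isBounded_Ioc (a + w) (a + w + s))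
    (Set.disjoint_left.2 fun x hx hx' => absurd hx.2 (not_le.2 hx'.1))
  have h2 := hsplit _ _ (Metric.isBounded_Ico a (a + s)) (Metric.isBounded_Icc a' (a' + w))
    (Set.disjoint_left.2 fun x hx hx' => absurd hx'.1 (not_le.2 (by linarith [hx.2])))
  rw [hu1] at h1
  rw [hu2, h1] at h2
  have h3 : ((tiltedPoints C S (Set.Icc a (a + w)) (Set.Icc b (b + h))).ncard : ℝ)
      + (tiltedPoints C S (Set.Ioc (a + w) (a + w + s)) (Set.Icc b (b + h))).ncard
      = (tiltedPoints C S (Set.Ico a (a + s)) (Set.Icc b (b + h))).ncard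
      + (tiltedPoints C S (Set.Icc a' (a' + w)) (Set.Icc b (b + h))).ncard := by
    exact_mod_cast h2
  have h4 := abs_le.1 (hthin (a + w)).1
  have h5 := abs_le.1 (hthin a).2
  rw [abs_le]
  constructor <;> linarith

/-- The half-open unit square. -/
def unitCell : Set (ℝ × ℝ) := Set.Ico 0 1 ×ˢ Set.Ico 0 1

lemma measurableSet_unitCell : MeasurableSet unitCell := measurableSet_Ico.prod measurableSet_Ico

lemma volume_unitCell : volume unitCell = 1 := by
  simp [unitCell, Measure.volume_eq_prod, Measure.prod_prod]

lemma volume_eq_lintegral_encard {R : Set (ℝ × ℝ)} (hR : MeasurableSet R) :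
    volume R = ∫⁻ u in unitCell,
      (({z : ℤ × ℤ | ((z.1 : ℝ) + u.1, (z.2 : ℝ) + u.2) ∈ R}.encard : ENat) : ENNReal) := by
  set v : ℤ × ℤ → ℝ × ℝ := fun z => ((z.1 : ℝ), (z.2 : ℝ)) with hv
  set cell : ℤ × ℤ → Set (ℝ × ℝ) := fun z => {x | -v z + x ∈ unitCell} with hcell
  have hmem : ∀ z x, x ∈ cell z ↔ z = (⌊x.1⌋, ⌊x.2⌋) := by
    rintro ⟨m, n⟩ ⟨x, y⟩
    simp only [hcell, hv, unitCell, Set.mem_ofPred_eq, Set.mem_prod, Set.mem_Ico, Prod.fst_add,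
      Prod.snd_add, Prod.fst_neg, Prod.snd_neg, Prod.mk.injEq]
    rw [eq_comm (a := m), eq_comm (a := n), Int.floor_eq_iff, Int.floor_eq_iff]
    constructor
    · rintro ⟨⟨h1, h2⟩, h3, h4⟩
      exact ⟨⟨by linarith, by linarith⟩, by linarith, by linarith⟩
    · rintro ⟨⟨h1, h2⟩, h3, h4⟩
      exact ⟨⟨by linarith, by linarith⟩, by linarith, by linarith⟩
  have hcellm : ∀ z, MeasurableSet (cell z) := fun z =>
    (measurable_const_add (-v z)) measurableSet_unitCell
  have hshift : ∀ z, MeasurableSet {u | v z + u ∈ R} := fun z => (measurable_const_add (v z)) hR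
  have hunion : R = ⋃ z, R ∩ cell z := by
    ext x
    simp [hmem]
  have hdisj : Pairwise (Function.onFun Disjoint fun z => R ∩ cell z) := by
    intro z z' hz
    rw [Function.onFun, Set.disjoint_left]
    exact fun x hx hx' => hz (((hmem _ _).1 hx.2).trans ((hmem _ _).1 hx'.2).symm)
  have hpiece : ∀ z, volume (R ∩ cell z)
      = ∫⁻ u in unitCell, {u | v z + u ∈ R}.indicator (fun _ => (1 : ENNReal)) u := by
    intro z
    rw [lintegral_indicator (hshift z), setLIntegral_one, Measure.restrict_apply (hshift z),
      ← measure_preimage_add volume (v z)]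
    congr 1
    ext u
    simp [hcell]
  calc volume R = volume (⋃ z, R ∩ cell z) := by rw [← hunion]
    _ = ∑' z, volume (R ∩ cell z) := measure_iUnion hdisj fun z => hR.inter (hcellm z)
    _ = ∑' z, ∫⁻ u in unitCell, {u | v z + u ∈ R}.indicator (fun _ => (1 : ENNReal)) u :=
        tsum_congr hpiece
    _ = ∫⁻ u in unitCell, ∑' z, {u | v z + u ∈ R}.indicator (fun _ => (1 : ENNReal)) u :=
        (lintegral_tsum fun z => (measurable_const.indicator (hshift z)).aemeasurable).symm
    _ = _ := by
        refine lintegral_congr fun u => ?_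
        rw [← ENNReal.tsum_set_one, tsum_subtype _ (fun _ => (1 : ENNReal))]
        rfl

/-- If the number of lattice points in `R - u` is close to `A` for every `u` in the unit cell,
then so is the area of `R`. -/
lemma abs_sub_volume_toReal_le {R : Set (ℝ × ℝ)} (hR : MeasurableSet R) {A E : ℝ}
    (hfin : ∀ u ∈ unitCell,
      {z : ℤ × ℤ | ((z.1 : ℝ) + u.1, (z.2 : ℝ) + u.2) ∈ R}.Finite)
    (hclose : ∀ u ∈ unitCell,
      |({z : ℤ × ℤ | ((z.1 : ℝ) + u.1, (z.2 : ℝ) + u.2) ∈ R}.ncard : ℝ) - A| ≤ E) :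
    |A - (volume R).toReal| ≤ E := by
  have hcast : ∀ u ∈ unitCell,
      (({z : ℤ × ℤ | ((z.1 : ℝ) + u.1, (z.2 : ℝ) + u.2) ∈ R}.encard : ENat) : ENNReal)
        = ENNReal.ofReal ({z : ℤ × ℤ | ((z.1 : ℝ) + u.1, (z.2 : ℝ) + u.2) ∈ R}.ncard : ℝ) := by
    intro u hu
    rw [← (hfin u hu).cast_ncard_eq]
    simp
  have hAE : 0 ≤ A + E := by
    have h0 : ((0 : ℝ), (0 : ℝ)) ∈ unitCell := by simp [unitCell]
    have := (abs_le.1 (hclose _ h0)).2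
    have h1 : (0 : ℝ) ≤ ({z : ℤ × ℤ | ((z.1 : ℝ) + (0 : ℝ), (z.2 : ℝ) + (0 : ℝ)) ∈ R}.ncard : ℝ) :=
      Nat.cast_nonneg _
    linarith
  have hup : volume R ≤ ENNReal.ofReal (A + E) := by
    rw [volume_eq_lintegral_encard hR]
    calc _ ≤ ∫⁻ _ in unitCell, ENNReal.ofReal (A + E) := by
          refine setLIntegral_mono' measurableSet_unitCell fun u hu => ?_
          rw [hcast u hu]
          exact ENNReal.ofReal_le_ofReal (by linarith [(abs_le.1 (hclose u hu)).2])
      _ = _ := by rw [setLIntegral_const, volume_unitCell, mul_one]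
  have hlo : ENNReal.ofReal (A - E) ≤ volume R := by
    rw [volume_eq_lintegral_encard hR]
    calc ENNReal.ofReal (A - E) = ∫⁻ _ in unitCell, ENNReal.ofReal (A - E) := by
          rw [setLIntegral_const, volume_unitCell, mul_one]
      _ ≤ _ := by
          refine setLIntegral_mono' measurableSet_unitCell fun u hu => ?_
          rw [hcast u hu]
          exact ENNReal.ofReal_le_ofReal (by linarith [(abs_le.1 (hclose u hu)).1])
  have hup' : (volume R).toReal ≤ A + E := ENNReal.toReal_le_of_le_ofReal hAE hup
  have hlo' : A - E ≤ (volume R).toReal :=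
    (ENNReal.ofReal_le_iff_le_toReal (hup.trans_lt ENNReal.ofReal_lt_top).ne).1 hlo
  rw [abs_le]
  constructor <;> linarith

lemma mem_rect_iff (φ : ℝ) (p : ℝ × ℝ) (w h : ℝ) (z : ℝ × ℝ) :
    z ∈ rect φ p w h ↔
      z.1 * Real.cos φ + z.2 * Real.sin φ ∈ Set.Icc (p.1 * Real.cos φ + p.2 * Real.sin φ)
        (p.1 * Real.cos φ + p.2 * Real.sin φ + w) ∧
      -(z.1 * Real.sin φ) + z.2 * Real.cos φ ∈ Set.Icc (-(p.1 * Real.sin φ) + p.2 * Real.cos φ)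
        (-(p.1 * Real.sin φ) + p.2 * Real.cos φ + h) := by
  obtain ⟨x, y⟩ := z
  obtain ⟨a, b⟩ := p
  have hcs := Real.cos_sq_add_sin_sq φ
  set C := Real.cos φ with hC
  set S := Real.sin φ with hS
  simp only [rect, rot, Set.mem_image, Set.mem_prod, Set.mem_Icc, Prod.exists, Prod.mk_add_mk,
    Prod.mk.injEq, ← hC, ← hS]
  constructor
  · rintro ⟨u, v, ⟨⟨hu0, hu1⟩, hv0, hv1⟩, rfl, rfl⟩
    have e1 : (a + (u * C - v * S)) * C + (b + (u * S + v * C)) * S = a * C + b * S + u := by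
      linear_combination u * hcs
    have e2 : -((a + (u * C - v * S)) * S) + (b + (u * S + v * C)) * C
        = -(a * S) + b * C + v := by
      linear_combination v * hcs
    rw [e1, e2]
    exact ⟨⟨by linarith, by linarith⟩, by linarith, by linarith⟩
  · rintro ⟨⟨h1, h2⟩, h3, h4⟩
    refine ⟨(x - a) * C + (y - b) * S, -((x - a) * S) + (y - b) * C,
      ⟨⟨by linarith, by linarith⟩, by linarith, by linarith⟩, ?_, ?_⟩
    · linear_combination (x - a) * hcs
    · linear_combination (y - b) * hcs

lemma measurableSet_rect (φ : ℝ) (p : ℝ × ℝ) (w h : ℝ) : MeasurableSet (rect φ p w h) := by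
  have hcont : Continuous fun x => p + rot φ x := by
    unfold rot
    fun_prop
  exact ((isCompact_Icc.prod isCompact_Icc).image hcont).measurableSet

lemma setOf_add_mem_rect (φ : ℝ) (p : ℝ × ℝ) (w h : ℝ) (u : ℝ × ℝ) :
    {z : ℤ × ℤ | ((z.1 : ℝ) + u.1, (z.2 : ℝ) + u.2) ∈ rect φ p w h}
      = tiltedPoints (Real.cos φ) (Real.sin φ)
        (Set.Icc ((p.1 - u.1) * Real.cos φ + (p.2 - u.2) * Real.sin φ)
          ((p.1 - u.1) * Real.cos φ + (p.2 - u.2) * Real.sin φ + w))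
        (Set.Icc (-((p.1 - u.1) * Real.sin φ) + (p.2 - u.2) * Real.cos φ)
          (-((p.1 - u.1) * Real.sin φ) + (p.2 - u.2) * Real.cos φ + h)) := by
  ext ⟨m, n⟩
  simp only [Set.mem_ofPred_eq, mem_rect_iff, tiltedPoints, Set.mem_Icc]
  constructor <;> rintro ⟨⟨h1, h2⟩, h3, h4⟩ <;>
    exact ⟨⟨by linarith, by linarith⟩, by linarith, by linarith⟩

lemma ncard_lattice_inter (R : Set (ℝ × ℝ)) :
    (lattice ∩ R).ncard = {z : ℤ × ℤ | ((z.1 : ℝ), (z.2 : ℝ)) ∈ R}.ncard := by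
  have hinj : Function.Injective fun z : ℤ × ℤ => ((z.1 : ℝ), (z.2 : ℝ)) := by
    rintro ⟨a, b⟩ ⟨c, d⟩ h
    simpa using h
  rw [← Set.ncard_image_of_injective _ hinj]
  congr 1
  ext x
  constructor
  · rintro ⟨⟨m, n, rfl⟩, hx⟩
    exact ⟨(m, n), hx, rfl⟩
  · rintro ⟨⟨m, n⟩, hx, rfl⟩
    exact ⟨⟨m, n, rfl⟩, hx⟩

/-- Discrepancy bound for a rectangle both of whose side directions are Diophantine. -/
lemma abs_discrepancy_rect_le {K β κ φ : ℝ} {p : ℝ × ℝ} {w h L : ℝ} (hβ : 0 < β) (hK0 : 0 < K)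
    (hK : ∀ (M : ℕ) (x : ℝ),
      |sawtoothSum (-Real.cos φ / Real.sin φ) x M| ≤ K * (M : ℝ) ^ β)
    (hK' : ∀ (M : ℕ) (x : ℝ),
      |sawtoothSum (Real.sin φ / Real.cos φ) x M| ≤ K * (M : ℝ) ^ β)
    (hκ : 0 < κ) (hS : κ ≤ |Real.sin φ|) (hC : κ ≤ |Real.cos φ|)
    (hw : 0 ≤ w) (hh : 0 ≤ h) (hwL : w ≤ L) (hhL : h ≤ L) :
    |((lattice ∩ rect φ p w h).ncard : ℝ) - (volume (rect φ p w h)).toReal|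
      ≤ 4 * (10 / κ + 2 * K * (L + 5) ^ β) := by
  have hcs := Real.cos_sq_add_sin_sq φ
  have hcs' : (-Real.sin φ) ^ 2 + Real.cos φ ^ 2 = 1 := by rw [neg_sq]; linarith
  have hfin : ∀ u ∈ unitCell,
      {z : ℤ × ℤ | ((z.1 : ℝ) + u.1, (z.2 : ℝ) + u.2) ∈ rect φ p w h}.Finite := by
    intro u _
    rw [setOf_add_mem_rect]
    exact tiltedPoints_finite _ _ hcs (Metric.isBounded_Icc _ _) (Metric.isBounded_Icc _ _)
  refine abs_sub_volume_toReal_le (measurableSet_rect φ p w h) hfin fun u hu => ?_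
  have h0 : {z : ℤ × ℤ | ((z.1 : ℝ), (z.2 : ℝ)) ∈ rect φ p w h}
      = {z : ℤ × ℤ | ((z.1 : ℝ) + (0 : ℝ × ℝ).1, (z.2 : ℝ) + (0 : ℝ × ℝ).2) ∈ rect φ p w h} := by
    simp
  rw [ncard_lattice_inter, h0, setOf_add_mem_rect, setOf_add_mem_rect]
  simp only [Prod.fst_zero, Prod.snd_zero, sub_zero]
  obtain ⟨⟨hu1, hu2⟩, hu3, hu4⟩ := hu
  have hc1 := abs_le.1 (Real.abs_cos_le_one φ)
  have hs1 := abs_le.1 (Real.abs_sin_le_one φ)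
  set C := Real.cos φ
  set S := Real.sin φ
  have hmono : ∀ l, 0 ≤ l → l ≤ L → 2 * (10 / κ + 2 * K * (l + 5) ^ β)
      ≤ 2 * (10 / κ + 2 * K * (L + 5) ^ β) := by
    intro l h1 h2
    gcongr
  set a := p.1 * C + p.2 * S
  set b := -(p.1 * S) + p.2 * C
  set a' := (p.1 - u.1) * C + (p.2 - u.2) * S with ha'
  set b' := -((p.1 - u.1) * S) + (p.2 - u.2) * C with hb'
  have haa : |a' - a| ≤ 2 := by
    have : a' - a = -(u.1 * C) - u.2 * S := by rw [ha']; ring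
    rw [this, abs_le]
    constructor <;> nlinarith
  have hbb : |b' - b| ≤ 2 := by
    have : b' - b = u.1 * S - u.2 * C := by rw [hb']; ring
    rw [this, abs_le]
    constructor <;> nlinarith
  have h1 := (abs_ncard_translate_sub_le (b := b') hβ hK hK0 hcs hκ hS hw hh a a' haa).trans
    (hmono h hh hhL)
  have h2 := (abs_ncard_translate_sub_le (b := -(a + w)) hβ (by simpa using hK') hK0 hcs' hκ hC
    hh hw b b' hbb).trans (hmono w hw hwL)
  have hJ : Set.Icc (-(a + w)) (-(a + w) + w) = -Set.Icc a (a + w) := by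
    rw [Set.neg_Icc]
    congr 1
    ring
  rw [hJ, ← tiltedPoints_rotate_frame, ← tiltedPoints_rotate_frame] at h2
  obtain ⟨h3, h4⟩ := abs_le.1 h1
  obtain ⟨h5, h6⟩ := abs_le.1 h2
  rw [abs_le]
  constructor <;> linarith

lemma sq_dist_le_of_mem_Vsq {α : ℝ} {N : ℕ} {x y : ℝ × ℝ} (hx : x ∈ Vsq α N) (hy : y ∈ Vsq α N) :
    (x.1 - y.1) ^ 2 + (x.2 - y.2) ^ 2 ≤ 2 * N := by
  obtain ⟨⟨a, b⟩, ⟨⟨ha0, ha1⟩, hb0, hb1⟩, rfl⟩ := hx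
  obtain ⟨⟨a', b'⟩, ⟨⟨ha0', ha1'⟩, hb0', hb1'⟩, rfl⟩ := hy
  have hN := Real.sq_sqrt (Nat.cast_nonneg N : (0 : ℝ) ≤ N)
  simp only [rot] at *
  have h1 : (a - a') ^ 2 ≤ N := by
    rw [← hN]
    exact sq_le_sq' (by linarith) (by linarith)
  have h2 : (b - b') ^ 2 ≤ N := by
    rw [← hN]
    exact sq_le_sq' (by linarith) (by linarith)
  have hcs := Real.cos_sq_add_sin_sq α
  calc _ = ((a - a') ^ 2 + (b - b') ^ 2) * (Real.cos α ^ 2 + Real.sin α ^ 2) := by ring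
    _ ≤ _ := by rw [hcs]; linarith

lemma sides_le_of_rect_subset_Vsq {α φ w h : ℝ} {p : ℝ × ℝ} {N : ℕ} (hw : 0 ≤ w) (hh : 0 ≤ h)
    (hsub : rect φ p w h ⊆ Vsq α N) : w ≤ 2 * √N ∧ h ≤ 2 * √N := by
  have hcs := Real.cos_sq_add_sin_sq φ
  have hN := Real.sq_sqrt (Nat.cast_nonneg N : (0 : ℝ) ≤ N)
  have hmem : ∀ u ∈ Set.Icc 0 w, ∀ v ∈ Set.Icc 0 h, p + rot φ (u, v) ∈ Vsq α N :=
    fun u hu v hv => hsub ⟨(u, v), ⟨hu, hv⟩, rfl⟩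
  have hO := hmem 0 ⟨le_rfl, hw⟩ 0 ⟨le_rfl, hh⟩
  have h1 := sq_dist_le_of_mem_Vsq (hmem w ⟨hw, le_rfl⟩ 0 ⟨le_rfl, hh⟩) hO
  have h2 := sq_dist_le_of_mem_Vsq (hmem 0 ⟨le_rfl, hw⟩ h ⟨hh, le_rfl⟩) hO
  simp only [rot, Prod.fst_add, Prod.snd_add] at h1 h2
  have hN0 : (0 : ℝ) ≤ N := Nat.cast_nonneg N
  constructor
  · refine le_of_sq_le_sq ?_ (by positivity)
    rw [mul_pow, hN]
    nlinarith
  · refine le_of_sq_le_sq ?_ (by positivity)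
    rw [mul_pow, hN]
    nlinarith

lemma div_one_add_le_abs {c x y : ℝ} (hc : 0 < c) (hxy : x ^ 2 + y ^ 2 = 1)
    (h : c < |y / x|) : c / (1 + c) ≤ |y| := by
  have hx : 0 < |x| := by
    rw [abs_pos]
    rintro rfl
    simp at h
    linarith
  rw [abs_div, lt_div_iff₀ hx] at h
  have h1 : 1 ≤ |x| + |y| := by
    have e : |x| ^ 2 + |y| ^ 2 = 1 := by rw [sq_abs, sq_abs, hxy]
    have := abs_nonneg y
    nlinarith
  rw [div_le_iff₀ (by linarith)]
  nlinarith

/-- Let `0 ≤ d < 1`, `τ = 2/(1-d)² - 2`, `ε > 0`, `Ω ⊆ (0, π/2)`, and let `α` satisfy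
the diophantine condition `|tan(α - θ) - p/q| > c q^{-2-τ-ε}` for all
`θ ∈ Ω ∪ {0} ∪ (Ω + π/2) ∪ {π/2}`. Then for every `N ≥ 2` and every rectangle
`R ⊆ V` (the square `[0, √N)²` rotated by `α`) with a side parallel to a side of `V`
or making angle `θ - α` with the x-axis for some `θ ∈ Ω`, the lattice point
discrepancy satisfies `|#(ℤ² ∩ R) - area(R)| ≤ C N^{(τ+ε)/(2(τ+ε+1))}` with `C`
independent of `N` and `R`. -/
theorem lattice_discrepancy_rotated_rectangles_minkowski
    (d : ℝ) (hd0 : 0 ≤ d) (hd1 : d < 1) (τ : ℝ) (hτ : τ = 2 / (1 - d) ^ 2 - 2)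
    (ε : ℝ) (hε : 0 < ε) (Ω : Set ℝ) (hΩ : Ω ⊆ Set.Ioo 0 (Real.pi / 2))
    (α : ℝ) (hα : α ∈ Set.Icc (0:ℝ) (Real.pi / 2)) (c : ℝ) (hc : 0 < c)
    (hdioph : ∀ θ' : ℝ,
      (θ' ∈ Ω ∨ θ' = 0 ∨ (∃ θ ∈ Ω, θ + Real.pi / 2 = θ') ∨ θ' = Real.pi / 2) →
      ∀ (p : ℤ) (q : ℕ), 0 < q →
        |Real.tan (α - θ') - (p : ℝ) / (q : ℝ)| > c * (q : ℝ) ^ (-2 - τ - ε)) :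
    ∃ C : ℝ, 0 < C ∧ ∀ N : ℕ, 2 ≤ N →
      ∀ (φ : ℝ) (p : ℝ × ℝ) (w h : ℝ), 0 < w → 0 < h →
        (φ = α ∨ ∃ θ ∈ Ω, θ - α = φ) → rect φ p w h ⊆ Vsq α N →
        |((lattice ∩ rect φ p w h).ncard : ℝ) - (volume (rect φ p w h)).toReal|
          ≤ C * (N : ℝ) ^ ((τ + ε) / (2 * (τ + ε + 1))) := by
  have hτ0 : 0 ≤ τ := by
    have h1 : (1 - d) ^ 2 ≤ 1 := by nlinarith
    have h2 : 0 < (1 - d) ^ 2 := by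
      have : 0 < 1 - d := by linarith
      positivity
    have : 2 ≤ 2 / (1 - d) ^ 2 := by
      rw [le_div_iff₀ h2]
      linarith
    linarith
  set σ := τ + ε with hσdef
  have hσ : 0 < σ := by linarith
  set β := σ / (1 + σ) with hβdef
  have hβ : 0 < β := by positivity
  have hdio : ∀ θ' : ℝ,
      (θ' ∈ Ω ∨ θ' = 0 ∨ (∃ θ ∈ Ω, θ + Real.pi / 2 = θ') ∨ θ' = Real.pi / 2) →
      IsDiophantine c σ (Real.tan (α - θ')) := by
    intro θ' hθ' m q hq
    have := hdioph θ' hθ' m q hq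
    rwa [show -2 - τ - ε = -2 - σ by rw [hσdef]; ring] at this
  have hcot : ∀ x : ℝ, Real.tan (x - Real.pi / 2) = -Real.cos x / Real.sin x := by
    intro x
    rw [Real.tan_eq_sin_div_cos, Real.sin_sub_pi_div_two, Real.cos_sub_pi_div_two]
  obtain ⟨K, hK0, hK⟩ := exists_sawtoothSum_bound hc hσ
  set κ := c / (1 + c) with hκdef
  have hκ : 0 < κ := by positivity
  refine ⟨4 * (10 / κ + 2 * K * 7 ^ β), by positivity, ?_⟩
  intro N hN φ p w h hw hh hφ hsub
  have hdirs : IsDiophantine c σ (-Real.cos φ / Real.sin φ) ∧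
      IsDiophantine c σ (Real.sin φ / Real.cos φ) := by
    rcases hφ with rfl | ⟨θ, hθ, rfl⟩
    · constructor
      · rw [← hcot]
        exact hdio _ (by simp)
      · rw [← Real.tan_eq_sin_div_cos]
        simpa using hdio 0 (by simp)
    · constructor
      · have h1 := (hdio (θ + Real.pi / 2) (Or.inr (Or.inr (Or.inl ⟨θ, hθ, rfl⟩)))).neg
        rw [← sub_sub, hcot, ← neg_sub θ α, Real.cos_neg, Real.sin_neg, div_neg, neg_neg] at h1
        exact h1
      · have h1 := (hdio θ (Or.inl hθ)).neg
        rw [← Real.tan_neg, neg_sub, Real.tan_eq_sin_div_cos] at h1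
        exact h1
  have hcs := Real.cos_sq_add_sin_sq φ
  have hS : κ ≤ |Real.sin φ| := div_one_add_le_abs hc hcs hdirs.2.lt_abs
  have hC : κ ≤ |Real.cos φ| := by
    refine div_one_add_le_abs (x := Real.sin φ) hc (by linarith) ?_
    have := hdirs.1.lt_abs
    rwa [neg_div, abs_neg] at this
  obtain ⟨hwL, hhL⟩ := sides_le_of_rect_subset_Vsq hw.le hh.le hsub
  refine (abs_discrepancy_rect_le hβ hK0 (hK _ hdirs.1) (hK _ hdirs.2) hκ hS hC hw.le hh.le hwL
    hhL).trans ?_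
  have hN1 : (1 : ℝ) ≤ N := by exact_mod_cast (by omega : 1 ≤ N)
  have hsq1 : 1 ≤ √(N : ℝ) := Real.one_le_sqrt.2 hN1
  have hpow : (√(N : ℝ)) ^ β = (N : ℝ) ^ (σ / (2 * (σ + 1))) := by
    rw [Real.sqrt_eq_rpow, ← Real.rpow_mul (by linarith)]
    congr 1
    rw [hβdef]
    field_simp
    ring
  rw [← hpow]
  have h1 : 1 ≤ (√(N : ℝ)) ^ β := Real.one_le_rpow hsq1 hβ.le
  have h2 : (2 * √(N : ℝ) + 5) ^ β ≤ 7 ^ β * (√(N : ℝ)) ^ β := by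
    rw [← Real.mul_rpow (by norm_num) (by positivity)]
    gcongr
    linarith
  have h3 : 10 / κ ≤ 10 / κ * (√(N : ℝ)) ^ β := le_mul_of_one_le_right (by positivity) h1
  calc 4 * (10 / κ + 2 * K * (2 * √(N : ℝ) + 5) ^ β)
      ≤ 4 * (10 / κ * (√(N : ℝ)) ^ β + 2 * K * (7 ^ β * (√(N : ℝ)) ^ β)) := by gcongr
    _ = _ := by ring

end
end

section
/- Let R ⊆ ℝ² be a (bounded, nondegenerate) convex polygon with sides T₁, ..., T_m, and for each side T_j let T_j* denote the closed halfplane whose boundary is the line containing T_j and which contains R. Let n = (n₁, n₂) ∈ ℤ² and let S = [n₁ − 1/2, n₁ + 1/2) × [n₂ − 1/2, n₂ + 1/2). Assume S intersects R but contains no vertex of R, and let T_{j₁}, ..., T_{j_k} be exactly those sides of R that intersect S. Then D(R ∩ S) = Σ_{i=1}^{k} D(T_{j_i}* ∩ S), where D(A) = #(ℤ² ∩ A) − area(A). -/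
open MeasureTheory
open scoped Classical

noncomputable section

/-- The lattice point discrepancy of a region: `D(A) = #(ℤ² ∩ A) - area(A)`. -/
def latDisc (A : Set (ℝ × ℝ)) : ℝ := ((lattice ∩ A).ncard : ℝ) - (volume A).toReal

/-- Along the segment from a point satisfying finitely many affine constraints to a point violating
one of them, there is a last parameter at which all of them hold; a constraint violated at the end
is tight there. -/
lemma exists_exit_time {ι : Type*} [Finite ι] (a b c : ι → ℝ) (ha : ∀ l, a l ≤ c l)
    (hb : ∃ l, c l < b l) :
    ∃ t : ℝ, 0 ≤ t ∧ t ≤ 1 ∧ (∀ l, (1 - t) * a l + t * b l ≤ c l) ∧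
      ∃ k, c k < b k ∧ (1 - t) * a k + t * b k = c k := by
  obtain ⟨k, hk, hmin⟩ := Set.exists_min_image {l | c l < b l}
    (fun l => (c l - a l) / (b l - a l)) (Set.toFinite _) hb
  have hk' : c k < b k := hk
  have hpos : 0 < b k - a k := by linarith [ha k]
  set t := (c k - a k) / (b k - a k) with ht
  have htk : t * (b k - a k) = c k - a k := div_mul_cancel₀ _ hpos.ne'
  have h0 : 0 ≤ t := div_nonneg (by linarith [ha k]) hpos.le
  have h1 : t ≤ 1 := (div_le_one hpos).2 (by linarith)
  refine ⟨t, h0, h1, fun l => ?_, k, hk, by linarith⟩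
  by_cases hl : c l < b l
  · have := (le_div_iff₀ (by linarith [ha l] : 0 < b l - a l)).1 (hmin l hl)
    linarith
  · nlinarith [ha l]

/-- The half-open unit square centred at a lattice point contains no other lattice point. -/
lemma lattice_inter_unitSquare (n : ℤ × ℤ) :
    lattice ∩ Set.Ico ((n.1 : ℝ) - 1 / 2) ((n.1 : ℝ) + 1 / 2) ×ˢ
      Set.Ico ((n.2 : ℝ) - 1 / 2) ((n.2 : ℝ) + 1 / 2) = {((n.1 : ℝ), (n.2 : ℝ))} := by
  have key (p q : ℤ) (h₁ : (p : ℝ) - 1 / 2 ≤ q) (h₂ : (q : ℝ) < p + 1 / 2) : q = p := by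
    have h₃ : p < q + 1 := by exact_mod_cast (by linarith : (p : ℝ) < q + 1)
    have h₄ : q < p + 1 := by exact_mod_cast (by linarith : (q : ℝ) < p + 1)
    omega
  ext x
  constructor
  · rintro ⟨⟨p, q, rfl⟩, ⟨h₁, h₂⟩, h₃, h₄⟩
    rw [key _ _ h₁ h₂, key _ _ h₃ h₄]
    rfl
  · rintro rfl
    exact ⟨⟨n.1, n.2, rfl⟩, ⟨by norm_num, by norm_num⟩, by norm_num, by norm_num⟩

/-- The half-open unit square centred at a lattice point has discrepancy zero. -/
lemma latDisc_unitSquare (n : ℤ × ℤ) :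
    latDisc (Set.Ico ((n.1 : ℝ) - 1 / 2) ((n.1 : ℝ) + 1 / 2) ×ˢ
      Set.Ico ((n.2 : ℝ) - 1 / 2) ((n.2 : ℝ) + 1 / 2)) = 0 := by
  rw [latDisc, lattice_inter_unitSquare, Set.ncard_singleton, Measure.volume_eq_prod,
    Measure.prod_prod, Real.volume_Ico, Real.volume_Ico]
  norm_num

/-- The discrepancy is additive on disjoint subsets of a set with finite area and finitely many
lattice points. -/
lemma latDisc_union {S A B : Set (ℝ × ℝ)} (hfin : (lattice ∩ S).Finite) (hvol : volume S ≠ ⊤)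
    (hA : A ⊆ S) (hB : B ⊆ S) (hmeas : MeasurableSet B) (hd : Disjoint A B) :
    latDisc (A ∪ B) = latDisc A + latDisc B := by
  have hfA := hfin.subset (Set.inter_subset_inter_right lattice hA)
  have hfB := hfin.subset (Set.inter_subset_inter_right lattice hB)
  rw [latDisc, latDisc, latDisc, Set.inter_union_distrib_left,
    Set.ncard_union_eq (hd.mono Set.inter_subset_right Set.inter_subset_right) hfA hfB,
    measure_union hd hmeas,
    ENNReal.toReal_add (measure_ne_top_of_subset hA hvol) (measure_ne_top_of_subset hB hvol)]
  push_cast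
  ring

lemma latDisc_biUnion {ι : Type*} {S : Set (ℝ × ℝ)} (hfin : (lattice ∩ S).Finite)
    (hvol : volume S ≠ ⊤) (A : ι → Set (ℝ × ℝ)) (hA : ∀ j, A j ⊆ S)
    (hmeas : ∀ j, MeasurableSet (A j)) (s : Finset ι)
    (hd : (s : Set ι).PairwiseDisjoint A) :
    latDisc (⋃ j ∈ s, A j) = ∑ j ∈ s, latDisc (A j) := by
  induction s using Finset.induction_on with
  | empty => simp [latDisc]
  | insert i s hi ih =>
    rw [Finset.coe_insert, Set.pairwiseDisjoint_insert_of_notMem (by simpa using hi)] at hd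
    rw [Finset.set_biUnion_insert, Finset.sum_insert hi, ← ih hd.1]
    refine latDisc_union hfin hvol (hA i) (Set.iUnion₂_subset fun j _ => hA j)
      (s.measurableSet_biUnion fun j _ => hmeas j) ?_
    exact Set.disjoint_iUnion₂_right.2 fun j hj => hd.2 j (by simpa using hj)

/-- A segment leaving an intersection of halfplanes does so through a point of a side whose halfplane
does not contain the endpoint of the segment. -/
lemma exists_exit_point {ι : Type*} [Finite ι] (u : ι → ℝ × ℝ) (c : ι → ℝ) {p x : ℝ × ℝ}
    (hp : ∀ l, p.1 * (u l).1 + p.2 * (u l).2 ≤ c l)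
    (hx : ∃ l, c l < x.1 * (u l).1 + x.2 * (u l).2) :
    ∃ z ∈ segment ℝ p x, (∀ l, z.1 * (u l).1 + z.2 * (u l).2 ≤ c l) ∧
      ∃ k, c k < x.1 * (u k).1 + x.2 * (u k).2 ∧ z.1 * (u k).1 + z.2 * (u k).2 = c k := by
  obtain ⟨t, h0, h1, hle, k, hk, heq⟩ := exists_exit_time
    (fun l => p.1 * (u l).1 + p.2 * (u l).2) (fun l => x.1 * (u l).1 + x.2 * (u l).2) c hp hx
  refine ⟨(1 - t) • p + t • x, ⟨1 - t, t, by linarith, h0, by ring, rfl⟩, fun l => ?_, k, hk, ?_⟩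
  · have := hle l
    simp only [Prod.fst_add, Prod.snd_add, Prod.smul_fst, Prod.smul_snd, smul_eq_mul]
    linarith
  · simp only [Prod.fst_add, Prod.snd_add, Prod.smul_fst, Prod.smul_snd, smul_eq_mul]
    linarith

/-- Two sides of a polygon meeting a convex set `S` that contains no vertex cut off disjoint
parts of `S`. -/
lemma disjoint_cutoffs {ι : Type*} [Finite ι] (u : ι → ℝ × ℝ) (c : ι → ℝ) {S : Set (ℝ × ℝ)}
    (hS : Convex ℝ S)
    (hvertex : ∀ z ∈ S, (∀ l, z.1 * (u l).1 + z.2 * (u l).2 ≤ c l) → ∀ i j, i ≠ j →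
      z.1 * (u i).1 + z.2 * (u i).2 = c i → z.1 * (u j).1 + z.2 * (u j).2 ≠ c j)
    {i j : ι} (hij : i ≠ j) {a b x : ℝ × ℝ} (haS : a ∈ S) (hbS : b ∈ S) (hxS : x ∈ S)
    (haR : ∀ l, a.1 * (u l).1 + a.2 * (u l).2 ≤ c l)
    (hbR : ∀ l, b.1 * (u l).1 + b.2 * (u l).2 ≤ c l)
    (ha : a.1 * (u i).1 + a.2 * (u i).2 = c i) (hb : b.1 * (u j).1 + b.2 * (u j).2 = c j)
    (hxi : c i < x.1 * (u i).1 + x.2 * (u i).2) :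
    x.1 * (u j).1 + x.2 * (u j).2 ≤ c j := by
  by_contra! hxj
  have hbi : b.1 * (u i).1 + b.2 * (u i).2 < c i :=
    lt_of_le_of_ne (hbR i) (hvertex b hbS hbR j i hij.symm hb)
  -- The point `q` of the segment from `b` to `x` lies on the line of side `i` but outside the polygon.
  obtain ⟨t, h0, h1, -, -, -, hq⟩ := exists_exit_time (ι := Unit)
    (fun _ => b.1 * (u i).1 + b.2 * (u i).2) (fun _ => x.1 * (u i).1 + x.2 * (u i).2)
    (fun _ => c i) (fun _ => hbR i) ⟨(), hxi⟩
  have htpos : 0 < t := by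
    rcases h0.eq_or_lt with rfl | h
    · linarith
    · exact h
  set q : ℝ × ℝ := (1 - t) • b + t • x with hqdef
  have hqS : q ∈ S := hS hbS hxS (by linarith) h0 (by ring)
  have hqi : q.1 * (u i).1 + q.2 * (u i).2 = c i := by
    simp only [hqdef, Prod.fst_add, Prod.snd_add, Prod.smul_fst, Prod.smul_snd, smul_eq_mul]
    linarith
  have hqj : c j < q.1 * (u j).1 + q.2 * (u j).2 := by
    simp only [hqdef, Prod.fst_add, Prod.snd_add, Prod.smul_fst, Prod.smul_snd, smul_eq_mul]
    have := mul_pos htpos (sub_pos.2 hxj)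
    rw [← hb] at this ⊢
    linarith
  obtain ⟨z, hz, hzR, k, hqk, hzk⟩ := exists_exit_point u c haR ⟨j, hqj⟩
  have hik : i ≠ k := by
    rintro rfl
    linarith
  refine hvertex z (hS.segment_subset haS hqS hz) hzR i k hik ?_ hzk
  obtain ⟨r, s, -, -, hrs, rfl⟩ := hz
  simp only [Prod.fst_add, Prod.snd_add, Prod.smul_fst, Prod.smul_snd, smul_eq_mul]
  linear_combination r * ha + s * hqi + c i * hrs

/-- Let `R` be a bounded, nondegenerate convex polygon given as the intersection of
the closed halfplanes `H j = {x : x ⬝ u j ≤ cst j}`, with sides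
`T j = R ∩ {x : x ⬝ u j = cst j}` (each a nondegenerate segment). Let
`S = [n₁ - 1/2, n₁ + 1/2) × [n₂ - 1/2, n₂ + 1/2)` be the unit square centered at a
lattice point. If `S` meets `R` but contains no vertex of `R`, then
`D(R ∩ S) = Σ D(T_j* ∩ S)`, the sum being over exactly those sides meeting `S`,
where `T_j* = H j` is the halfplane determined by the side `T j` containing `R`. -/
theorem polygon_square_discrepancy_decomposition
    (m : ℕ) (u : Fin m → ℝ × ℝ) (hu : ∀ j, u j ≠ 0) (cst : Fin m → ℝ)
    (H : Fin m → Set (ℝ × ℝ))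
    (hH : ∀ j, H j = {x : ℝ × ℝ | x.1 * (u j).1 + x.2 * (u j).2 ≤ cst j})
    (R : Set (ℝ × ℝ)) (hR : R = ⋂ j, H j)
    (hbdd : Bornology.IsBounded R) (hint : (interior R).Nonempty)
    (T : Fin m → Set (ℝ × ℝ))
    (hT : ∀ j, T j = R ∩ {x : ℝ × ℝ | x.1 * (u j).1 + x.2 * (u j).2 = cst j})
    (hside : ∀ j, ∃ x y : ℝ × ℝ, x ≠ y ∧ T j = segment ℝ x y)
    (n : ℤ × ℤ) (S : Set (ℝ × ℝ))
    (hS : S = Set.Ico ((n.1 : ℝ) - 1 / 2) ((n.1 : ℝ) + 1 / 2) ×ˢ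
      Set.Ico ((n.2 : ℝ) - 1 / 2) ((n.2 : ℝ) + 1 / 2))
    (hmeets : (S ∩ R).Nonempty)
    (hnovertex : ∀ i j : Fin m, i ≠ j → S ∩ (T i ∩ T j) = ∅) :
    latDisc (R ∩ S) =
      ∑ j ∈ Finset.univ.filter (fun j : Fin m => (T j ∩ S).Nonempty),
        latDisc (H j ∩ S) := by
  have hmemR (x : ℝ × ℝ) : x ∈ R ↔ ∀ l, x.1 * (u l).1 + x.2 * (u l).2 ≤ cst l := by
    simp [hR, hH]
  have hmemH (j : Fin m) (x : ℝ × ℝ) : x ∈ H j ↔ x.1 * (u j).1 + x.2 * (u j).2 ≤ cst j := by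
    simp [hH]
  have hmemT (j : Fin m) (x : ℝ × ℝ) :
      x ∈ T j ↔ x ∈ R ∧ x.1 * (u j).1 + x.2 * (u j).2 = cst j := by
    simp [hT]
  have hHmeas (j : Fin m) : MeasurableSet (H j) := by
    rw [hH]
    exact measurableSet_le (by fun_prop) measurable_const
  have hSconv : Convex ℝ S := hS ▸ (convex_Ico _ _).prod (convex_Ico _ _)
  have hSmeas : MeasurableSet S := hS ▸ measurableSet_Ico.prod measurableSet_Ico
  have hSfin : (lattice ∩ S).Finite := by
    rw [hS, lattice_inter_unitSquare]
    exact Set.finite_singleton _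
  have hSvol : volume S ≠ ⊤ := by
    rw [hS, Measure.volume_eq_prod, Measure.prod_prod, Real.volume_Ico, Real.volume_Ico]
    exact ENNReal.mul_ne_top ENNReal.ofReal_ne_top ENNReal.ofReal_ne_top
  have hSdisc : latDisc S = 0 := hS ▸ latDisc_unitSquare n
  have hvertex : ∀ z ∈ S, (∀ l, z.1 * (u l).1 + z.2 * (u l).2 ≤ cst l) → ∀ i j, i ≠ j →
      z.1 * (u i).1 + z.2 * (u i).2 = cst i → z.1 * (u j).1 + z.2 * (u j).2 ≠ cst j := by
    intro z hzS hzR i j hij hi hj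
    have hz : z ∈ S ∩ (T i ∩ T j) := ⟨hzS, (hmemT i z).2 ⟨(hmemR z).2 hzR, hi⟩,
      (hmemT j z).2 ⟨(hmemR z).2 hzR, hj⟩⟩
    rw [hnovertex i j hij] at hz
    exact hz
  have hcompl (A : Set (ℝ × ℝ)) (hA : MeasurableSet A) :
      latDisc (A ∩ S) = -latDisc (S \ A) := by
    have h := latDisc_union hSfin hSvol Set.inter_subset_right Set.sdiff_subset
      (hSmeas.diff hA) (A := A ∩ S) (Set.disjoint_left.2 fun x hx hx' => hx'.2 hx.1)
    rw [Set.inter_comm, Set.inter_union_sdiff, hSdisc] at h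
    rw [Set.inter_comm]
    linarith
  set J := Finset.univ.filter (fun j : Fin m => (T j ∩ S).Nonempty)
  have hcover : S \ R = ⋃ j ∈ J, S \ H j := by
    ext x
    simp only [Set.mem_iUnion, exists_prop]
    constructor
    · rintro ⟨hxS, hxR⟩
      obtain ⟨p, hpS, hpR⟩ := hmeets
      rw [hmemR] at hpR hxR
      push Not at hxR
      obtain ⟨z, hz, hzR, k, hxk, hzk⟩ := exists_exit_point u cst hpR hxR
      refine ⟨k, ?_, hxS, fun h => hxk.not_ge ((hmemH k x).1 h)⟩
      exact Finset.mem_filter.2 ⟨Finset.mem_univ k, z,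
        (hmemT k z).2 ⟨(hmemR z).2 hzR, hzk⟩, hSconv.segment_subset hpS hxS hz⟩
    · rintro ⟨j, -, hxS, hxj⟩
      exact ⟨hxS, fun hxR => hxj ((hmemH j x).2 ((hmemR x).1 hxR j))⟩
  have hdisj : (J : Set (Fin m)).PairwiseDisjoint fun j => S \ H j := by
    intro i hi j hj hij
    obtain ⟨a, haT, haS⟩ := (Finset.mem_filter.1 hi).2
    obtain ⟨b, hbT, hbS⟩ := (Finset.mem_filter.1 hj).2
    rw [hmemT, hmemR] at haT hbT
    refine Set.disjoint_left.2 fun x hxi hxj => hxj.2 ((hmemH j x).2 ?_)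
    exact disjoint_cutoffs u cst hSconv hvertex hij haS hbS hxi.1 haT.1 hbT.1 haT.2 hbT.2
      (not_le.1 fun h => hxi.2 ((hmemH i x).2 h))
  have hRmeas : MeasurableSet R := hR ▸ MeasurableSet.iInter hHmeas
  rw [hcompl R hRmeas, hcover, latDisc_biUnion hSfin hSvol _ (fun _ => Set.sdiff_subset)
    (fun j => hSmeas.diff (hHmeas j)) J hdisj, ← Finset.sum_neg_distrib]
  exact Finset.sum_congr rfl fun j _ => (hcompl (H j) (hHmeas j)).symm

end
end
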